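/- arXiv:2511.04878 — 2 statements merged into one kernel-verified Lean document; each statement's English description precedes it below -/
import Mathlib

section
/- Let n ≥ 1 and p, q ≥ 1 be integers and let s > -1 be real. Then c_pq(s) = [Γ(s+n+1)Γ(s+1+2n)/(Γ(n)³Γ(2s+2n+2))] · (p)_n (q)_n · ∫₀¹∫₀¹ x^{p-1} y^{q-1} (1-x)^{n+s} (1-y)^{n+s} ₂F₁(s+1, n+s+1; 2n+2s+2; 1-xy) dx dy. -/
open MeasureTheory ENNReal NNReal

/-- Pochhammer symbol `(a)_k = Γ(a+k)/Γ(a)`. -/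
noncomputable def poch (a : ℝ) (k : ℕ) : ℝ := Real.Gamma (a + k) / Real.Gamma a

/-- Gauss hypergeometric function `₂F₁(a,b;c;t)`, as a sum of its series. -/
noncomputable def hyp2F1 (a b c t : ℝ) : ℝ :=
  ∑' k : ℕ, (poch a k * poch b k) / (poch c k * (Nat.factorial k)) * t ^ k

/-- `S_pq(t)`. -/
noncomputable def Spq (n p q : ℕ) (t : ℝ) : ℝ :=
  (Real.Gamma (n + p) * Real.Gamma (n + q)) / (Real.Gamma n * Real.Gamma ((n : ℝ) + p + q)) *
    hyp2F1 p q ((p : ℝ) + q + n) t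

/-- `c_pq(s)`. -/
noncomputable def cpq (n p q : ℕ) (s : ℝ) : ℝ :=
  poch (s + 1) n / Real.Gamma n *
    ∫ t in Set.Ioo (0:ℝ) 1, t ^ ((p : ℝ) + q + n - 1) * (1 - t) ^ s * (Spq n p q t) ^ 2

open ProbabilityTheory (beta beta_pos)

lemma poch_pos {a : ℝ} (ha : 0 < a) (k : ℕ) : 0 < poch a k :=
  div_pos (Real.Gamma_pos_of_pos (by positivity)) (Real.Gamma_pos_of_pos ha)

lemma poch_eq_ascPochhammer {a : ℝ} (ha : 0 < a) (k : ℕ) :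
    poch a k = (ascPochhammer ℝ k).eval a := by
  induction k with
  | zero => simp [poch, (Real.Gamma_pos_of_pos ha).ne']
  | succ k ih =>
    rw [ascPochhammer_succ_eval, ← ih, poch, poch, Nat.cast_succ, ← add_assoc,
      Real.Gamma_add_one (by positivity)]
    ring

lemma hasSum_poch_rpow_neg {a u : ℝ} (ha : 0 < a) (hu : |u| < 1) :
    HasSum (fun k : ℕ => poch a k / k.factorial * u ^ k) ((1 - u) ^ (-a)) := by
  have h := (Real.one_div_one_sub_rpow_hasFPowerSeriesOnBall_zero a).hasSum (y := u)
    (by simpa [enorm_eq_nnnorm, ← NNReal.coe_lt_coe] using hu)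
  have h1 : 0 ≤ 1 - u := by linarith [(abs_lt.1 hu).2]
  simp only [zero_add, one_div, ← Real.rpow_neg h1] at h
  refine (congrArg (fun f => HasSum f _) (funext fun k => ?_)).mpr h
  have hk : (k.factorial : ℝ) ≠ 0 := by positivity
  have h2 := Ring.factorial_nsmul_multichoose_eq_ascPochhammer a k
  rw [Polynomial.ascPochhammer_smeval_eq_eval, Ring.multichoose_eq, nsmul_eq_mul,
    ← poch_eq_ascPochhammer ha] at h2
  rw [← h2]
  simp [mul_comm, hk]

lemma lintegral_rpow_mul_one_sub_rpow {α β : ℝ} (hα : 0 < α) (hβ : 0 < β) :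
    ∫⁻ x in Set.Ioo (0 : ℝ) 1, ENNReal.ofReal (x ^ (α - 1) * (1 - x) ^ (β - 1)) =
      ENNReal.ofReal (beta α β) := by
  have h := ProbabilityTheory.lintegral_betaPDF_eq_one hα hβ
  have hb := beta_pos hα hβ
  rw [ProbabilityTheory.lintegral_betaPDF] at h
  simp_rw [mul_assoc, ENNReal.ofReal_mul (one_div_pos.2 hb).le] at h
  rw [lintegral_const_mul' _ _ ENNReal.ofReal_ne_top, one_div, ENNReal.ofReal_inv_of_pos hb,
    mul_comm, ← div_eq_mul_inv] at h
  exact (ENNReal.div_eq_one_iff (by simpa using hb) ENNReal.ofReal_ne_top).1 h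

lemma beta_add_natCast {b d : ℝ} (hb : 0 < b) (hd : 0 < d) (k : ℕ) :
    beta (b + k) d = beta b d * poch b k / poch (b + d) k := by
  have h1 := (Real.Gamma_pos_of_pos hb).ne'
  have h2 := (Real.Gamma_pos_of_pos (add_pos hb hd)).ne'
  rw [beta, beta, poch, poch, add_right_comm b k d]
  field_simp

/-- The integral in the Euler representation of `₂F₁(a, b; b + d; z)`. -/
noncomputable def eulerLIntegral (a b d z : ℝ) : ℝ≥0∞ :=
  ∫⁻ x in Set.Ioo (0 : ℝ) 1,
    ENNReal.ofReal (x ^ (b - 1) * (1 - x) ^ (d - 1) * (1 - z * x) ^ (-a))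

/-- The Euler integral representation. -/
lemma hyp2F1_eq_lintegral {a b d z : ℝ} (ha : 0 < a) (hb : 0 < b) (hd : 0 < d)
    (hz : 0 ≤ z) (hz1 : z ≤ 1) :
    hyp2F1 a b (b + d) z = (beta b d)⁻¹ * (eulerLIntegral a b d z).toReal := by
  rw [eulerLIntegral]
  have hbeta := beta_pos hb hd
  have hterm : ∀ x ∈ Set.Ioo (0 : ℝ) 1,
      ENNReal.ofReal (x ^ (b - 1) * (1 - x) ^ (d - 1) * (1 - z * x) ^ (-a)) =
      ∑' k : ℕ, ENNReal.ofReal (poch a k / k.factorial * z ^ k) *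
        ENNReal.ofReal (x ^ (b + k - 1) * (1 - x) ^ (d - 1)) := by
    rintro x ⟨hx0, hx1⟩
    have hx1' : 0 < 1 - x := by linarith
    have hzx : |z * x| < 1 := by rw [abs_of_nonneg (by positivity)]; nlinarith
    have hs := (hasSum_poch_rpow_neg ha hzx).mul_left (x ^ (b - 1) * (1 - x) ^ (d - 1))
    rw [← hs.tsum_eq, ENNReal.ofReal_tsum_of_nonneg _ hs.summable]
    · refine tsum_congr fun k => ?_
      have := poch_pos ha k
      rw [← ENNReal.ofReal_mul (by positivity), add_sub_right_comm, Real.rpow_add hx0,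
        Real.rpow_natCast, mul_pow]
      congr 1
      ring
    · intro k
      have := poch_pos ha k
      positivity
  rw [setLIntegral_congr_fun measurableSet_Ioo hterm,
    lintegral_tsum fun k => by fun_prop]
  simp_rw [lintegral_const_mul' _ _ ENNReal.ofReal_ne_top]
  have hk : ∀ k : ℕ, ∫⁻ x in Set.Ioo (0 : ℝ) 1,
      ENNReal.ofReal (x ^ (b + k - 1) * (1 - x) ^ (d - 1)) = ENNReal.ofReal (beta (b + k) d) :=
    fun k => lintegral_rpow_mul_one_sub_rpow (by positivity) hd
  simp_rw [hk]
  rw [ENNReal.tsum_toReal_eq fun k => by finiteness, hyp2F1, ← _root_.tsum_mul_left]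
  refine tsum_congr fun k => ?_
  have h1 := poch_pos ha k
  have h2 := beta_pos (show 0 < b + (k : ℝ) by positivity) hd
  have h3 := poch_pos (add_pos hb hd) k
  rw [ENNReal.toReal_mul, ENNReal.toReal_ofReal (by positivity), ENNReal.toReal_ofReal h2.le,
    beta_add_natCast hb hd]
  field_simp

lemma lintegral_Ioo_reflect (f : ℝ → ℝ≥0∞) :
    ∫⁻ x in Set.Ioo (0 : ℝ) 1, f x = ∫⁻ x in Set.Ioo (0 : ℝ) 1, f (1 - x) := by
  have h := lintegral_image_eq_lintegral_abs_deriv_mul (s := Set.Ioo (0 : ℝ) 1)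
    (f := fun x => 1 - x) (f' := fun _ => -1) measurableSet_Ioo
    (fun x _ => ((hasDerivAt_id x).const_sub 1).hasDerivWithinAt)
    (fun x _ y _ hxy => by simpa using hxy) f
  simpa using h

/-- The substitution `t = x / (c + (1 - c) x)`. -/
lemma lintegral_Ioo_moebius {c : ℝ} (hc : 0 < c) (f : ℝ → ℝ≥0∞) :
    ∫⁻ t in Set.Ioo (0 : ℝ) 1, f t = ∫⁻ x in Set.Ioo (0 : ℝ) 1,
      ENNReal.ofReal (c / (c + (1 - c) * x) ^ 2) * f (x / (c + (1 - c) * x)) := by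
  have hpos : ∀ x ∈ Set.Ioo (0 : ℝ) 1, 0 < c + (1 - c) * x := by
    rintro x ⟨h0, h1⟩; nlinarith
  have himg : (fun x => x / (c + (1 - c) * x)) '' Set.Ioo (0 : ℝ) 1 = Set.Ioo 0 1 := by
    ext t
    constructor
    · rintro ⟨x, hx, rfl⟩
      have := hpos x hx
      refine ⟨div_pos hx.1 this, (div_lt_one this).2 ?_⟩
      nlinarith [hx.2]
    · rintro ⟨h0, h1⟩
      have hd : 0 < 1 - t + c * t := by nlinarith
      refine ⟨c * t / (1 - t + c * t), ⟨by positivity, (div_lt_one hd).2 (by linarith)⟩, ?_⟩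
      have : c + (1 - c) * (c * t / (1 - t + c * t)) = c / (1 - t + c * t) := by
        field_simp; ring
      simp only [this]
      field_simp
  have h := lintegral_image_eq_lintegral_abs_deriv_mul (s := Set.Ioo (0 : ℝ) 1)
    (f := fun x => x / (c + (1 - c) * x)) (f' := fun x => c / (c + (1 - c) * x) ^ 2)
    measurableSet_Ioo ?_ ?_ f
  · rw [himg] at h
    rw [h]
    refine lintegral_congr fun x => ?_
    rw [abs_of_nonneg (by positivity)]
  · intro x hx
    have := hpos x hx
    have h := (hasDerivAt_id' x).fun_div
      (((hasDerivAt_id' x).const_mul (1 - c)).const_add c) this.ne'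
    rw [show 1 * (c + (1 - c) * x) - x * ((1 - c) * 1) = c by ring] at h
    exact h.hasDerivWithinAt
  · intro x hx y hy hxy
    have h1 := hpos x hx
    have h2 := hpos y hy
    rw [div_eq_div_iff h1.ne' h2.ne'] at hxy
    have : c * (x - y) = 0 := by linarith
    rcases mul_eq_zero.1 this with h | h <;> linarith

lemma moebius_monomial {X Y P Q W u v X' Y' : ℝ} (p q N s : ℝ) (hX : 0 < X) (hY : 0 < Y)
    (hP : 0 < P) (hQ : 0 < Q) (hW : 0 < W) (hu : 0 < u) (hv : 0 < v) (hX' : 0 < X')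
    (hY' : 0 < Y') :
    u / P ^ 2 * (u / Q ^ 2 * (X' * Y' * P * Q / W ^ 2 *
      ((P * Q / W) ^ (p + q + N - 1) * (v * u * X' * Y' / W) ^ s *
        ((X / P) ^ (p - 1) * (u * X' / P) ^ (q + N - 1) * (u * X' / W) ^ (-q)) *
        ((Y / Q) ^ (q - 1) * (u * Y' / Q) ^ (p + N - 1) * (u * Y' / W) ^ (-p))))) =
    X ^ (p - 1) * Y ^ (q - 1) * X' ^ (N + s) * Y' ^ (N + s) *
      (v ^ s * u ^ (2 * N + s) * W ^ (-(N + s + 1))) := by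
  obtain ⟨X, rfl⟩ : ∃ a, Real.exp a = X := ⟨_, Real.exp_log hX⟩
  obtain ⟨Y, rfl⟩ : ∃ a, Real.exp a = Y := ⟨_, Real.exp_log hY⟩
  obtain ⟨P, rfl⟩ : ∃ a, Real.exp a = P := ⟨_, Real.exp_log hP⟩
  obtain ⟨Q, rfl⟩ : ∃ a, Real.exp a = Q := ⟨_, Real.exp_log hQ⟩
  obtain ⟨W, rfl⟩ : ∃ a, Real.exp a = W := ⟨_, Real.exp_log hW⟩
  obtain ⟨u, rfl⟩ : ∃ a, Real.exp a = u := ⟨_, Real.exp_log hu⟩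
  obtain ⟨v, rfl⟩ : ∃ a, Real.exp a = v := ⟨_, Real.exp_log hv⟩
  obtain ⟨X', rfl⟩ : ∃ a, Real.exp a = X' := ⟨_, Real.exp_log hX'⟩
  obtain ⟨Y', rfl⟩ : ∃ a, Real.exp a = Y' := ⟨_, Real.exp_log hY'⟩
  simp only [← Real.exp_nat_mul, ← Real.exp_add, ← Real.exp_sub, ← Real.exp_mul]
  congr 1
  push_cast
  ring

/-- The integrand obtained by inserting the Euler integral for both factors `S_pq`. -/
noncomputable def tripleIntegrand (p q N s x y t : ℝ) : ℝ :=
  t ^ (p + q + N - 1) * (1 - t) ^ s *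
    (x ^ (p - 1) * (1 - x) ^ (q + N - 1) * (1 - t * x) ^ (-q)) *
    (y ^ (q - 1) * (1 - y) ^ (p + N - 1) * (1 - t * y) ^ (-p))

lemma tripleIntegrand_moebius (p q N s : ℝ) {X Y u x y c : ℝ} (hX : X ∈ Set.Ioo (0 : ℝ) 1)
    (hY : Y ∈ Set.Ioo (0 : ℝ) 1) (hu : u ∈ Set.Ioo (0 : ℝ) 1)
    (hx : x = X / (u + (1 - u) * X)) (hy : y = Y / (u + (1 - u) * Y))
    (hc : c = (1 - x) * (1 - y)) :
    u / (u + (1 - u) * X) ^ 2 * (u / (u + (1 - u) * Y) ^ 2 * (c / (c + (1 - c) * u) ^ 2 *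
      tripleIntegrand p q N s x y (u / (c + (1 - c) * u)))) =
    X ^ (p - 1) * Y ^ (q - 1) * (1 - X) ^ (N + s) * (1 - Y) ^ (N + s) *
      ((1 - u) ^ s * u ^ (2 * N + s) * (1 - (1 - X * Y) * (1 - u)) ^ (-(N + s + 1))) := by
  obtain ⟨hX0, hX1⟩ := hX
  obtain ⟨hY0, hY1⟩ := hY
  obtain ⟨hu0, hu1⟩ := hu
  have hX' : 0 < 1 - X := by linarith
  have hY' : 0 < 1 - Y := by linarith
  have hv : 0 < 1 - u := by linarith
  have hP : 0 < u + (1 - u) * X := by positivity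
  have hQ : 0 < u + (1 - u) * Y := by positivity
  have hW : 0 < 1 - (1 - X * Y) * (1 - u) := by nlinarith [mul_pos (mul_pos hX0 hY0) hv]
  rw [← moebius_monomial p q N s hX0 hY0 hP hQ hW hu0 hv hX' hY']
  have e1 : 1 - x = u * (1 - X) / (u + (1 - u) * X) := by rw [hx]; field_simp; ring
  have e2 : 1 - y = u * (1 - Y) / (u + (1 - u) * Y) := by rw [hy]; field_simp; ring
  have e3 : c + (1 - c) * u = u * (1 - (1 - X * Y) * (1 - u)) /
      ((u + (1 - u) * X) * (u + (1 - u) * Y)) := by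
    rw [hc, e1, e2]; field_simp; ring
  have e4 : c / (c + (1 - c) * u) ^ 2 = (1 - X) * (1 - Y) * (u + (1 - u) * X) *
      (u + (1 - u) * Y) / (1 - (1 - X * Y) * (1 - u)) ^ 2 := by
    rw [e3, hc, e1, e2]; field_simp
  have e5 : u / (c + (1 - c) * u) = (u + (1 - u) * X) * (u + (1 - u) * Y) /
      (1 - (1 - X * Y) * (1 - u)) := by
    rw [e3]; field_simp
  have e6 : 1 - (u + (1 - u) * X) * (u + (1 - u) * Y) / (1 - (1 - X * Y) * (1 - u)) =
      (1 - u) * u * (1 - X) * (1 - Y) / (1 - (1 - X * Y) * (1 - u)) := by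
    rw [one_sub_div hW.ne']; congr 1; ring
  have e7 : 1 - (u + (1 - u) * X) * (u + (1 - u) * Y) / (1 - (1 - X * Y) * (1 - u)) * x =
      u * (1 - X) / (1 - (1 - X * Y) * (1 - u)) := by
    rw [div_mul_eq_mul_div, one_sub_div hW.ne', hx]; congr 1; field_simp; ring
  have e8 : 1 - (u + (1 - u) * X) * (u + (1 - u) * Y) / (1 - (1 - X * Y) * (1 - u)) * y =
      u * (1 - Y) / (1 - (1 - X * Y) * (1 - u)) := by
    rw [div_mul_eq_mul_div, one_sub_div hW.ne', hy]; congr 1; field_simp; ring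
  rw [e4, tripleIntegrand, e5, e6, e7, e8, e1, e2, hx, hy]

lemma lintegral_swap_last {μ : Measure ℝ} [SFinite μ] {f : ℝ → ℝ → ℝ → ℝ≥0∞}
    (hf : Measurable fun z : ℝ × ℝ × ℝ => f z.1 z.2.1 z.2.2) :
    ∫⁻ t, ∫⁻ x, ∫⁻ y, f x y t ∂μ ∂μ ∂μ = ∫⁻ x, ∫⁻ y, ∫⁻ t, f x y t ∂μ ∂μ ∂μ := by
  rw [lintegral_lintegral_swap]
  · refine lintegral_congr fun x => lintegral_lintegral_swap ?_
    exact (hf.comp (by fun_prop : Measurable fun z : ℝ × ℝ => (x, z.2, z.1))).aemeasurable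
  · refine (Measurable.lintegral_prod_right' (f := fun z : (ℝ × ℝ) × ℝ => f z.1.2 z.2 z.1.1)
      ?_).aemeasurable
    exact hf.comp (by fun_prop : Measurable fun z : (ℝ × ℝ) × ℝ => (z.1.2, z.2, z.1.1))

lemma measurable_eulerLIntegral (a b d : ℝ) : Measurable (eulerLIntegral a b d) :=
  Measurable.lintegral_prod_right' (f := fun z : ℝ × ℝ =>
    ENNReal.ofReal (z.2 ^ (b - 1) * (1 - z.2) ^ (d - 1) * (1 - z.1 * z.2) ^ (-a))) (by fun_prop)

lemma eulerLIntegral_le {a b d z : ℝ} (ha : 0 < a) (hb : 0 < b) (hd : a < d) (hz : z ≤ 1) :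
    eulerLIntegral a b d z ≤ ENNReal.ofReal (beta b (d - a)) := by
  rw [← lintegral_rpow_mul_one_sub_rpow hb (sub_pos.2 hd)]
  refine setLIntegral_mono' measurableSet_Ioo fun x hx => ENNReal.ofReal_le_ofReal ?_
  have h0 := hx.1
  have h1 : 0 < 1 - x := by linarith [hx.2]
  have : (1 - z * x) ^ (-a) ≤ (1 - x) ^ (-a) :=
    Real.rpow_le_rpow_of_nonpos h1 (by nlinarith) (by linarith)
  calc _ ≤ x ^ (b - 1) * (1 - x) ^ (d - 1) * (1 - x) ^ (-a) := by gcongr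
    _ = _ := by rw [mul_assoc, ← Real.rpow_add h1]; ring_nf

lemma lintegral_mul_eulerLIntegral_mul_eulerLIntegral (p q N s : ℝ) :
    ∫⁻ t in Set.Ioo (0 : ℝ) 1, ENNReal.ofReal (t ^ (p + q + N - 1) * (1 - t) ^ s) *
      eulerLIntegral q p (q + N) t * eulerLIntegral p q (p + N) t =
    ∫⁻ x in Set.Ioo (0 : ℝ) 1, ∫⁻ y in Set.Ioo (0 : ℝ) 1,
      ENNReal.ofReal (x ^ (p - 1) * y ^ (q - 1) * (1 - x) ^ (N + s) * (1 - y) ^ (N + s)) *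
        eulerLIntegral (N + s + 1) (s + 1) (2 * N + s + 1) (1 - x * y) := by
  have hexpand : ∀ t ∈ Set.Ioo (0 : ℝ) 1,
      ENNReal.ofReal (t ^ (p + q + N - 1) * (1 - t) ^ s) *
        eulerLIntegral q p (q + N) t * eulerLIntegral p q (p + N) t =
      ∫⁻ x in Set.Ioo (0 : ℝ) 1, ∫⁻ y in Set.Ioo (0 : ℝ) 1,
        ENNReal.ofReal (tripleIntegrand p q N s x y t) := by
    rintro t ⟨ht0, ht1⟩
    have ht1' : 0 < 1 - t := by linarith
    rw [eulerLIntegral, eulerLIntegral, ← lintegral_const_mul' _ _ ENNReal.ofReal_ne_top,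
      ← lintegral_mul_const _ (by fun_prop)]
    refine setLIntegral_congr_fun measurableSet_Ioo fun x ⟨hx0, hx1⟩ => ?_
    have hx1' : 0 < 1 - x := by linarith
    have htx : 0 < 1 - t * x := by nlinarith
    rw [← ENNReal.ofReal_mul (by positivity), ← lintegral_const_mul' _ _ ENNReal.ofReal_ne_top]
    refine lintegral_congr fun y => ?_
    rw [← ENNReal.ofReal_mul (by positivity), tripleIntegrand]
  rw [setLIntegral_congr_fun measurableSet_Ioo hexpand, lintegral_swap_last
    (f := fun x y t => ENNReal.ofReal (tripleIntegrand p q N s x y t))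
    (by unfold tripleIntegrand; fun_prop)]
  have hsub : ∀ x ∈ Set.Ioo (0 : ℝ) 1, ∫⁻ y in Set.Ioo (0 : ℝ) 1, ∫⁻ t in Set.Ioo (0 : ℝ) 1,
        ENNReal.ofReal (tripleIntegrand p q N s x y t) =
      ∫⁻ y in Set.Ioo (0 : ℝ) 1, ∫⁻ u in Set.Ioo (0 : ℝ) 1,
        ENNReal.ofReal ((1 - x) * (1 - y) / ((1 - x) * (1 - y) +
          (1 - (1 - x) * (1 - y)) * u) ^ 2) * ENNReal.ofReal (tripleIntegrand p q N s x y
            (u / ((1 - x) * (1 - y) + (1 - (1 - x) * (1 - y)) * u))) := fun x hx =>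
    setLIntegral_congr_fun measurableSet_Ioo fun y hy =>
      lintegral_Ioo_moebius (mul_pos (sub_pos.2 hx.2) (sub_pos.2 hy.2)) _
  rw [setLIntegral_congr_fun measurableSet_Ioo hsub, ← lintegral_swap_last
    (f := fun x y u => ENNReal.ofReal ((1 - x) * (1 - y) / ((1 - x) * (1 - y) +
          (1 - (1 - x) * (1 - y)) * u) ^ 2) * ENNReal.ofReal (tripleIntegrand p q N s x y
            (u / ((1 - x) * (1 - y) + (1 - (1 - x) * (1 - y)) * u))))
    (by unfold tripleIntegrand; fun_prop)]
  have hcore : ∀ u ∈ Set.Ioo (0 : ℝ) 1, ∫⁻ x in Set.Ioo (0 : ℝ) 1, ∫⁻ y in Set.Ioo (0 : ℝ) 1,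
        ENNReal.ofReal ((1 - x) * (1 - y) / ((1 - x) * (1 - y) +
          (1 - (1 - x) * (1 - y)) * u) ^ 2) * ENNReal.ofReal (tripleIntegrand p q N s x y
            (u / ((1 - x) * (1 - y) + (1 - (1 - x) * (1 - y)) * u))) =
      ∫⁻ x in Set.Ioo (0 : ℝ) 1, ∫⁻ y in Set.Ioo (0 : ℝ) 1,
        ENNReal.ofReal (x ^ (p - 1) * y ^ (q - 1) * (1 - x) ^ (N + s) * (1 - y) ^ (N + s) *
          ((1 - u) ^ s * u ^ (2 * N + s) * (1 - (1 - x * y) * (1 - u)) ^ (-(N + s + 1)))) := by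
    intro u hu
    have hu0 := hu.1
    have hu1 : 0 < 1 - u := sub_pos.2 hu.2
    rw [lintegral_Ioo_moebius hu0]
    refine setLIntegral_congr_fun measurableSet_Ioo fun X hX => ?_
    have hX0 := hX.1
    have hX1 : 0 < 1 - X := sub_pos.2 hX.2
    rw [lintegral_Ioo_moebius hu0, ← lintegral_const_mul' _ _ ENNReal.ofReal_ne_top]
    refine setLIntegral_congr_fun measurableSet_Ioo fun Y hY => ?_
    have hY0 := hY.1
    have hY1 : 0 < 1 - Y := sub_pos.2 hY.2
    have e1 : 1 - X / (u + (1 - u) * X) = u * (1 - X) / (u + (1 - u) * X) := by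
      field_simp; ring
    have e2 : 1 - Y / (u + (1 - u) * Y) = u * (1 - Y) / (u + (1 - u) * Y) := by
      field_simp; ring
    have hc : 0 ≤ (1 - X / (u + (1 - u) * X)) * (1 - Y / (u + (1 - u) * Y)) := by
      rw [e1, e2]; positivity
    rw [← tripleIntegrand_moebius p q N s hX hY hu rfl rfl rfl,
      ENNReal.ofReal_mul (by positivity), ENNReal.ofReal_mul (by positivity),
      ENNReal.ofReal_mul (div_nonneg hc (by positivity))]
  rw [setLIntegral_congr_fun measurableSet_Ioo hcore, lintegral_swap_last
    (f := fun x y u => ENNReal.ofReal (x ^ (p - 1) * y ^ (q - 1) * (1 - x) ^ (N + s) *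
      (1 - y) ^ (N + s) *
          ((1 - u) ^ s * u ^ (2 * N + s) * (1 - (1 - x * y) * (1 - u)) ^ (-(N + s + 1)))))
    (by fun_prop)]
  refine setLIntegral_congr_fun measurableSet_Ioo fun x hx =>
    setLIntegral_congr_fun measurableSet_Ioo fun y hy => ?_
  have hx0 := hx.1
  have hx1 : 0 < 1 - x := sub_pos.2 hx.2
  have hy0 := hy.1
  have hy1 : 0 < 1 - y := sub_pos.2 hy.2
  rw [lintegral_Ioo_reflect, eulerLIntegral, ← lintegral_const_mul' _ _ ENNReal.ofReal_ne_top]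
  refine lintegral_congr fun u => ?_
  rw [← ENNReal.ofReal_mul (by positivity)]
  simp only [_root_.sub_sub_cancel, add_sub_cancel_right]

lemma hyp2F1_comm (a b c z : ℝ) : hyp2F1 a b c z = hyp2F1 b a c z := by
  simp only [hyp2F1, mul_comm (poch a _)]

lemma beta_inv_mul_eq (n p q : ℕ) (hn : 1 ≤ n) (hp : 1 ≤ p) (hq : 1 ≤ q) :
    (Real.Gamma (n + p) * Real.Gamma (n + q)) / (Real.Gamma n * Real.Gamma ((n : ℝ) + p + q)) *
      (beta p (q + n))⁻¹ = poch p n / Real.Gamma n := by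
  have h1 := (Real.Gamma_pos_of_pos (show (0 : ℝ) < n by positivity)).ne'
  have h2 := (Real.Gamma_pos_of_pos (show (0 : ℝ) < p by positivity)).ne'
  have h3 := (Real.Gamma_pos_of_pos (show (0 : ℝ) < q + n by positivity)).ne'
  have h4 := (Real.Gamma_pos_of_pos (show (0 : ℝ) < n + p + q by positivity)).ne'
  rw [beta, poch, show (p : ℝ) + (q + n) = n + p + q by ring, add_comm (n : ℝ) q,
    add_comm (p : ℝ) n]
  field_simp

lemma Spq_eq_left {n p q : ℕ} (hn : 1 ≤ n) (hp : 1 ≤ p) (hq : 1 ≤ q) {t : ℝ} (ht0 : 0 ≤ t)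
    (ht1 : t ≤ 1) :
    Spq n p q t = poch p n / Real.Gamma n * (eulerLIntegral q p (q + n) t).toReal := by
  rw [Spq, hyp2F1_comm, add_assoc (p : ℝ), hyp2F1_eq_lintegral (by positivity) (by positivity)
    (by positivity) ht0 ht1, ← mul_assoc, beta_inv_mul_eq n p q hn hp hq]

lemma Spq_comm (n p q : ℕ) (t : ℝ) : Spq n p q t = Spq n q p t := by
  rw [Spq, Spq, hyp2F1_comm, mul_comm (Real.Gamma (n + p)), add_right_comm (n : ℝ) p q,
    add_comm (p : ℝ) q]

lemma cpq_integral_eq {n p q : ℕ} (hn : 1 ≤ n) (hp : 1 ≤ p) (hq : 1 ≤ q) (s : ℝ) :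
    ∫ t in Set.Ioo (0 : ℝ) 1, t ^ ((p : ℝ) + q + n - 1) * (1 - t) ^ s * (Spq n p q t) ^ 2 =
      poch p n * poch q n / Real.Gamma n ^ 2 *
        (∫⁻ t in Set.Ioo (0 : ℝ) 1, ENNReal.ofReal (t ^ ((p : ℝ) + q + n - 1) * (1 - t) ^ s) *
          eulerLIntegral q p (q + n) t * eulerLIntegral p q (p + n) t).toReal := by
  have hn' : (0 : ℝ) < n := by positivity
  have hp' : (0 : ℝ) < p := by positivity
  have hq' : (0 : ℝ) < q := by positivity
  have := measurable_eulerLIntegral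
  rw [← integral_toReal (by fun_prop), ← integral_const_mul]
  · refine setIntegral_congr_fun measurableSet_Ioo fun t ht => ?_
    have h0 := ht.1
    have h1 : 0 < 1 - t := sub_pos.2 ht.2
    simp only [ENNReal.toReal_mul]
    rw [ENNReal.toReal_ofReal (by positivity), sq]
    nth_rewrite 2 [Spq_comm]
    rw [Spq_eq_left hn hp hq h0.le ht.2.le, Spq_eq_left hn hq hp h0.le ht.2.le]
    ring
  · refine (ae_restrict_iff' measurableSet_Ioo).2 (.of_forall fun t ht => ?_)
    have hA := (eulerLIntegral_le hq' hp' (show (q : ℝ) < q + n by linarith) ht.2.le).trans_lt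
      ENNReal.ofReal_lt_top
    have hB := (eulerLIntegral_le hp' hq' (show (p : ℝ) < p + n by linarith) ht.2.le).trans_lt
      ENNReal.ofReal_lt_top
    finiteness

lemma integral_hyp2F1_eq {p q N s : ℝ} (hq : 1 ≤ q) (hN : 1 ≤ N) (hs : -1 < s) :
    ∫ x in Set.Ioo (0 : ℝ) 1, ∫ y in Set.Ioo (0 : ℝ) 1,
        x ^ (p - 1) * y ^ (q - 1) * (1 - x) ^ (N + s) * (1 - y) ^ (N + s) *
          hyp2F1 (s + 1) (N + s + 1) (2 * N + 2 * s + 2) (1 - x * y) =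
      (beta (s + 1) (2 * N + s + 1))⁻¹ *
        (∫⁻ x in Set.Ioo (0 : ℝ) 1, ∫⁻ y in Set.Ioo (0 : ℝ) 1,
          ENNReal.ofReal (x ^ (p - 1) * y ^ (q - 1) * (1 - x) ^ (N + s) * (1 - y) ^ (N + s)) *
            eulerLIntegral (N + s + 1) (s + 1) (2 * N + s + 1) (1 - x * y)).toReal := by
  have hE := measurable_eulerLIntegral (N + s + 1) (s + 1) (2 * N + s + 1)
  have hg : Measurable fun z : ℝ × ℝ =>
      ENNReal.ofReal (z.1 ^ (p - 1) * z.2 ^ (q - 1) * (1 - z.1) ^ (N + s) *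
        (1 - z.2) ^ (N + s)) *
        eulerLIntegral (N + s + 1) (s + 1) (2 * N + s + 1) (1 - z.1 * z.2) := by fun_prop
  have hle : ∀ x ∈ Set.Ioo (0 : ℝ) 1, ∀ y ∈ Set.Ioo (0 : ℝ) 1,
      ENNReal.ofReal (x ^ (p - 1) * y ^ (q - 1) * (1 - x) ^ (N + s) * (1 - y) ^ (N + s)) *
        eulerLIntegral (N + s + 1) (s + 1) (2 * N + s + 1) (1 - x * y) ≤
      ENNReal.ofReal (x ^ (p - 1) * (1 - x) ^ (N + s)) *
        ENNReal.ofReal (beta (s + 1) (2 * N + s + 1 - (N + s + 1))) := by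
    rintro x ⟨hx0, hx1⟩ y ⟨hy0, hy1⟩
    have hx1' : 0 < 1 - x := sub_pos.2 hx1
    have hy1' : 0 < 1 - y := sub_pos.2 hy1
    refine mul_le_mul' (ENNReal.ofReal_le_ofReal ?_) (eulerLIntegral_le (by linarith)
      (by linarith) (by linarith) (by nlinarith [mul_pos hx0 hy0]))
    have h1 : y ^ (q - 1) ≤ 1 := Real.rpow_le_one hy0.le hy1.le (by linarith)
    have h2 : (1 - y) ^ (N + s) ≤ 1 := Real.rpow_le_one hy1'.le (by linarith) (by linarith)
    calc _ = x ^ (p - 1) * (1 - x) ^ (N + s) * (y ^ (q - 1) * (1 - y) ^ (N + s)) := by ring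
      _ ≤ x ^ (p - 1) * (1 - x) ^ (N + s) * (1 * 1) := by gcongr
      _ = _ := by ring
  rw [← integral_toReal hg.lintegral_prod_right'.aemeasurable, ← integral_const_mul]
  · refine setIntegral_congr_fun measurableSet_Ioo fun x hx => ?_
    simp only
    rw [← integral_toReal (by fun_prop), ← integral_const_mul]
    · refine setIntegral_congr_fun measurableSet_Ioo fun y hy => ?_
      obtain ⟨hx0, hx1⟩ := hx
      obtain ⟨hy0, hy1⟩ := hy
      have hx1' : 0 < 1 - x := sub_pos.2 hx1
      have hy1' : 0 < 1 - y := sub_pos.2 hy1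
      rw [ENNReal.toReal_mul, ENNReal.toReal_ofReal (by positivity), hyp2F1_comm,
        show 2 * N + 2 * s + 2 = s + 1 + (2 * N + s + 1) by ring,
        hyp2F1_eq_lintegral (by linarith) (by linarith) (by linarith) (by nlinarith)
          (by nlinarith [mul_pos hx0 hy0])]
      ring
    · exact (ae_restrict_iff' measurableSet_Ioo).2 (.of_forall fun y hy =>
        (hle x hx y hy).trans_lt (by finiteness))
  · refine (ae_restrict_iff' measurableSet_Ioo).2 (.of_forall fun x hx => ?_)
    refine (setLIntegral_mono' measurableSet_Ioo (hle x hx)).trans_lt ?_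
    rw [lintegral_const]
    simp only [Measure.restrict_apply_univ, Real.volume_Ioo]
    finiteness

/-- Theorem 3.2 (first formula for `c_pq(s)`), restricted to `s > -1`. -/
theorem statement0 (n p q : ℕ) (hn : 1 ≤ n) (hp : 1 ≤ p) (hq : 1 ≤ q) (s : ℝ) (hs : -1 < s) :
    cpq n p q s =
      Real.Gamma (s + n + 1) * Real.Gamma (s + 1 + 2 * n) /
          (Real.Gamma n ^ 3 * Real.Gamma (2 * s + 2 * n + 2)) *
        (poch p n * poch q n) *
        ∫ x in Set.Ioo (0:ℝ) 1, ∫ y in Set.Ioo (0:ℝ) 1,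
          x ^ ((p : ℝ) - 1) * y ^ ((q : ℝ) - 1) *
            (1 - x) ^ ((n : ℝ) + s) * (1 - y) ^ ((n : ℝ) + s) *
            hyp2F1 (s + 1) ((n : ℝ) + s + 1) (2 * n + 2 * s + 2) (1 - x * y) := by
  rw [cpq, cpq_integral_eq hn hp hq, lintegral_mul_eulerLIntegral_mul_eulerLIntegral,
    integral_hyp2F1_eq (by exact_mod_cast hq) (by exact_mod_cast hn) hs]
  have hn' : (1 : ℝ) ≤ n := by exact_mod_cast hn
  have h1 := (Real.Gamma_pos_of_pos (show (0 : ℝ) < n by positivity)).ne'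
  have h2 := (Real.Gamma_pos_of_pos (show 0 < s + 1 by linarith)).ne'
  have h3 := (Real.Gamma_pos_of_pos (show 0 < 2 * n + s + 1 by linarith)).ne'
  have h4 := (Real.Gamma_pos_of_pos (show 0 < 2 * s + 2 * n + 2 by linarith)).ne'
  rw [beta, show s + 1 + (2 * n + s + 1) = 2 * s + 2 * n + 2 by ring, poch,
    show s + 1 + 2 * (n : ℝ) = 2 * n + s + 1 by ring, add_right_comm s 1 (n : ℝ)]
  generalize Real.Gamma (2 * n + s + 1) = A at *
  generalize Real.Gamma (2 * s + 2 * n + 2) = B at *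
  field_simp
end

section
/- Let n > 0 be a real number with n ∉ ℤ, let p, q ≥ 1 be integers and let s > -1 be real. Then c_pq(s) = ((s+1)_n/Γ(n)) · [ Σ_{k=0}^∞ T(k) − Σ_{k=0}^∞ T(n+k) ], where T(u) := Γ(p+u)Γ(q+u)Γ(p+n)Γ(q+n)Γ(1-n)Γ(s+u+1)Γ(n+s+u+1) / [Γ(n)Γ(1-n+u)Γ(1+u)Γ(p)Γ(q)Γ(p+n+s+1+u)Γ(q+n+s+1+u)], both series converging absolutely. -/
open MeasureTheory ENNReal NNReal

/-- Pochhammer symbol with a real increment, `(a)_x = Γ(a+x)/Γ(a)`. -/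
noncomputable def pochR (a x : ℝ) : ℝ := Real.Gamma (a + x) / Real.Gamma a

/-- `S_pq(t)` for a real parameter `ν` in place of the dimension `n`. -/
noncomputable def SpqR (ν : ℝ) (p q : ℕ) (t : ℝ) : ℝ :=
  (Real.Gamma (ν + p) * Real.Gamma (ν + q)) / (Real.Gamma ν * Real.Gamma (ν + p + q)) *
    hyp2F1 p q ((p : ℝ) + q + ν) t

/-- `c_pq(s)` for a real parameter `ν` in place of the dimension `n`. -/
noncomputable def cpqR (ν : ℝ) (p q : ℕ) (s : ℝ) : ℝ :=
  pochR (s + 1) ν / Real.Gamma ν *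
    ∫ t in Set.Ioo (0:ℝ) 1, t ^ ((p : ℝ) + q + ν - 1) * (1 - t) ^ s * (SpqR ν p q t) ^ 2

open Filter Topology Set

theorem HasSum.of_eq {f g : ℕ → ℝ} {s t : ℝ} (h : HasSum f s) (hfg : ∀ k, f k = g k)
    (hst : s = t) : HasSum g t :=
  hst ▸ funext hfg ▸ h

section PowerSeries

/-- The real power series with coefficients `a` converges absolutely on `(-1, 1)`. -/
def ConvergesOnUnit (a : ℕ → ℝ) : Prop :=
  ∀ r : ℝ, 0 ≤ r → r < 1 → Summable fun k => |a k| * r ^ k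

theorem convergesOnUnit_of_ratio {a : ℕ → ℝ} (ha : ∀ k, a k ≠ 0)
    (h : Tendsto (fun k => a (k + 1) / a k) atTop (𝓝 1)) : ConvergesOnUnit a := by
  intro r hr0 hr1
  rcases hr0.eq_or_lt with rfl | hr0
  · refine summable_of_ne_finset_zero (s := {0}) fun k hk => ?_
    simp at hk
    simp [hk]
  · refine summable_of_ratio_test_tendsto_lt_one hr1 (.of_forall fun k => ?_) ?_
    · have := ha k
      positivity
    · have h2 := (h.abs.mul_const r)
      simp only [abs_one, one_mul] at h2
      refine h2.congr fun k => ?_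
      have := ha k
      have h3 : |a k| ≠ 0 := by positivity
      simp only [Real.norm_eq_abs, abs_mul, abs_abs, abs_pow, abs_of_pos hr0, abs_div,
        pow_succ]
      field_simp

namespace ConvergesOnUnit

variable {a : ℕ → ℝ}

theorem summable (h : ConvergesOnUnit a) {x : ℝ} (hx : |x| < 1) :
    Summable fun k => a k * x ^ k := by
  refine Summable.of_norm ?_
  simpa [abs_mul, abs_pow] using h |x| (abs_nonneg x) hx

theorem hasSum (h : ConvergesOnUnit a) {x : ℝ} (hx : |x| < 1) :
    HasSum (fun k => a k * x ^ k) (∑' k, a k * x ^ k) :=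
  (h.summable hx).hasSum

theorem nat_mul (h : ConvergesOnUnit a) : ConvergesOnUnit fun k => k * a k := by
  intro r hr0 hr1
  have hρ0 : 0 < (1 + r) / 2 := by linarith
  have hρ1 : (1 + r) / 2 < 1 := by linarith
  have hq : r / ((1 + r) / 2) < 1 := by rw [div_lt_one hρ0]; linarith
  obtain ⟨C, hC⟩ := (tendsto_self_mul_const_pow_of_lt_one (by positivity) hq).bddAbove_range
  refine Summable.of_nonneg_of_le (fun k => by positivity) (fun k => ?_)
    ((h _ hρ0.le hρ1).mul_left C)
  have h1 : (k : ℝ) * (r / ((1 + r) / 2)) ^ k ≤ C := hC ⟨k, rfl⟩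
  calc |(k : ℝ) * a k| * r ^ k
      = (k * (r / ((1 + r) / 2)) ^ k) * (|a k| * ((1 + r) / 2) ^ k) := by
        rw [abs_mul, Nat.abs_cast, div_pow]
        field_simp
    _ ≤ _ := by gcongr

theorem succ (h : ConvergesOnUnit a) : ConvergesOnUnit fun k => a (k + 1) := by
  intro r hr0 hr1
  rcases hr0.eq_or_lt with rfl | hr0
  · refine summable_of_ne_finset_zero (s := {0}) fun k hk => ?_
    simp at hk
    simp [hk]
  · have h1 := ((_root_.summable_nat_add_iff 1).2 (h r hr0.le hr1)).mul_left r⁻¹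
    refine h1.congr fun k => ?_
    rw [pow_succ]
    field_simp

theorem deriv (h : ConvergesOnUnit a) : ConvergesOnUnit fun k => (k + 1) * a (k + 1) := by
  simpa using h.nat_mul.succ

theorem hasDerivAt (h : ConvergesOnUnit a) {x : ℝ} (hx : |x| < 1) :
    HasDerivAt (fun y => ∑' k, a k * y ^ k) (∑' k : ℕ, (k + 1) * a (k + 1) * x ^ k) x := by
  obtain ⟨r, hxr, hr1⟩ := exists_between hx
  have hr0 : 0 < r := (abs_nonneg x).trans_lt hxr
  have hu : Summable fun k : ℕ => |(k : ℝ) * a k| * r ^ (k - 1) := by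
    refine (_root_.summable_nat_add_iff 1).1 ?_
    simpa using h.deriv r hr0.le hr1
  have key := hasDerivAt_tsum_of_isPreconnected (y₀ := 0) (t := Ioo (-r) r) (y := x)
    (g := fun k y => a k * y ^ k) (g' := fun k y => a k * (k * y ^ (k - 1))) hu isOpen_Ioo
    isPreconnected_Ioo (fun k y _ => (hasDerivAt_pow k y).const_mul (a k))
    (fun k y hy => by
      have : |y| ≤ r := (abs_lt.2 hy).le
      rw [Real.norm_eq_abs, ← mul_assoc, abs_mul, mul_comm (a k), abs_pow]
      gcongr)
    ⟨by linarith, hr0⟩ (h.summable (by simp)) (abs_lt.1 hxr)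
  refine key.congr_deriv ?_
  have hs : Summable fun k : ℕ => a k * (k * x ^ (k - 1)) := by
    refine (_root_.summable_nat_add_iff 1).1 ((h.deriv.summable hx).congr fun k => ?_)
    push_cast
    ring_nf
  rw [hs.tsum_eq_zero_add]
  simp only [Nat.cast_zero, zero_mul, mul_zero, zero_add, Nat.cast_add, Nat.cast_one,
    Nat.add_sub_cancel]
  exact tsum_congr fun k => by ring

theorem hasSum_nat_mul (h : ConvergesOnUnit a) {x : ℝ} (hx : |x| < 1) :
    HasSum (fun k : ℕ => k * a k * x ^ k) (x * ∑' k : ℕ, (k + 1) * a (k + 1) * x ^ k) := by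
  refine (hasSum_nat_add_iff' 1).1 ?_
  simp only [Finset.range_one, Finset.sum_singleton, Nat.cast_zero, zero_mul, sub_zero]
  exact ((h.deriv.hasSum hx).mul_left x).of_eq (fun k => by push_cast; ring) rfl

theorem hasSum_succ (h : ConvergesOnUnit a) {x : ℝ} (hx : |x| < 1) (hx0 : x ≠ 0) :
    HasSum (fun k : ℕ => a (k + 1) * x ^ k) (((∑' k, a k * x ^ k) - a 0) / x) := by
  have h1 := ((hasSum_nat_add_iff' 1).2 (h.hasSum hx)).div_const x
  simp only [Finset.range_one, Finset.sum_singleton, pow_zero, mul_one] at h1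
  exact h1.of_eq (fun k => by rw [pow_succ]; field_simp) rfl

end ConvergesOnUnit

end PowerSeries

section GammaQuotient

theorem tendsto_add_div_add_natCast (a b : ℝ) :
    Tendsto (fun k : ℕ => (a + k) / (b + k)) atTop (𝓝 1) := by
  simpa using tendsto_add_mul_div_add_mul_atTop_nhds a b 1 (one_ne_zero (α := ℝ))

theorem ne_neg_natCast_of_pos {a : ℝ} (ha : 0 < a) (m : ℕ) : a ≠ -m := by
  have : (0 : ℝ) ≤ m := m.cast_nonneg
  intro h
  linarith

theorem add_natCast_ne_zero {a : ℝ} (ha : ∀ m : ℕ, a ≠ -m) (k : ℕ) : a + k ≠ 0 :=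
  fun h => ha k (by linarith)

theorem gamma_add_natCast_ne_zero {a : ℝ} (ha : ∀ m : ℕ, a ≠ -m) (k : ℕ) :
    Real.Gamma (a + k) ≠ 0 :=
  Real.Gamma_ne_zero fun m h => ha (k + m) (by push_cast; linarith)

theorem gamma_add_natCast_succ {a : ℝ} (ha : ∀ m : ℕ, a ≠ -m) (k : ℕ) :
    Real.Gamma (a + (k + 1 : ℕ)) = (a + k) * Real.Gamma (a + k) := by
  rw [← Real.Gamma_add_one (add_natCast_ne_zero ha k)]
  push_cast
  ring_nf

theorem gamma_add_natCast_eq_prod {a : ℝ} (ha : ∀ m : ℕ, a ≠ -m) (k : ℕ) :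
    Real.Gamma (a + k) = Real.Gamma a * ∏ j ∈ Finset.range k, (a + j) := by
  induction k with
  | zero => simp
  | succ k ih =>
    rw [gamma_add_natCast_succ ha, ih, Finset.prod_range_succ]
    ring

theorem tendsto_gamma_add_div {a : ℝ} (ha : ∀ m : ℕ, a ≠ -m) :
    Tendsto (fun k : ℕ => Real.Gamma (a + k) / ((k : ℝ) ^ a * Real.Gamma k)) atTop (𝓝 1) := by
  have h1 := (tendsto_const_nhds (x := Real.Gamma a)).div (Real.GammaSeq_tendsto_Gamma a)
    (Real.Gamma_ne_zero ha)
  rw [div_self (Real.Gamma_ne_zero ha)] at h1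
  have h2 := h1.mul (tendsto_add_div_add_natCast 0 a)
  rw [mul_one] at h2
  refine h2.congr' ?_
  filter_upwards [eventually_gt_atTop 0] with k hk
  have hk' : (0 : ℝ) < k := by exact_mod_cast hk
  have hf : (k.factorial : ℝ) = k * Real.Gamma k := by
    rw [← Real.Gamma_add_one hk'.ne', Real.Gamma_nat_eq_factorial]
  have hP : ∏ j ∈ Finset.range k, (a + (j : ℝ)) ≠ 0 :=
    Finset.prod_ne_zero_iff.2 fun j _ => add_natCast_ne_zero ha j
  have := add_natCast_ne_zero ha k
  have := (Real.rpow_pos_of_pos hk' a).ne'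
  have := (Real.Gamma_pos_of_pos hk').ne'
  simp only [Pi.div_apply, Real.GammaSeq]
  rw [Finset.prod_range_succ, hf, gamma_add_natCast_eq_prod ha, zero_add]
  field_simp

/-- The quotient `Γ(a+k) Γ(b+k) / (Γ(c+k) Γ(d+k))`. -/
noncomputable def gammaQuot (a b c d : ℝ) (k : ℕ) : ℝ :=
  Real.Gamma (a + k) * Real.Gamma (b + k) / (Real.Gamma (c + k) * Real.Gamma (d + k))

variable {a b c d : ℝ}

theorem gammaQuot_pos (ha : 0 < a) (hb : 0 < b) (hc : 0 < c) (hd : 0 < d) (k : ℕ) :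
    0 < gammaQuot a b c d k := by
  have := Real.Gamma_pos_of_pos (show 0 < a + k by positivity)
  have := Real.Gamma_pos_of_pos (show 0 < b + k by positivity)
  have := Real.Gamma_pos_of_pos (show 0 < c + k by positivity)
  have := Real.Gamma_pos_of_pos (show 0 < d + k by positivity)
  unfold gammaQuot
  positivity

theorem gammaQuot_ne_zero (ha : ∀ m : ℕ, a ≠ -m) (hb : ∀ m : ℕ, b ≠ -m) (hc : ∀ m : ℕ, c ≠ -m)
    (hd : ∀ m : ℕ, d ≠ -m) (k : ℕ) : gammaQuot a b c d k ≠ 0 :=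
  div_ne_zero (mul_ne_zero (gamma_add_natCast_ne_zero ha k) (gamma_add_natCast_ne_zero hb k))
    (mul_ne_zero (gamma_add_natCast_ne_zero hc k) (gamma_add_natCast_ne_zero hd k))

theorem gammaQuot_succ (ha : ∀ m : ℕ, a ≠ -m) (hb : ∀ m : ℕ, b ≠ -m) (hc : ∀ m : ℕ, c ≠ -m)
    (hd : ∀ m : ℕ, d ≠ -m) (k : ℕ) :
    gammaQuot a b c d (k + 1) =
      ((a + k) / (c + k)) * ((b + k) / (d + k)) * gammaQuot a b c d k := by
  unfold gammaQuot
  rw [gamma_add_natCast_succ ha, gamma_add_natCast_succ hb, gamma_add_natCast_succ hc,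
    gamma_add_natCast_succ hd]
  have := add_natCast_ne_zero hc k
  have := add_natCast_ne_zero hd k
  have := gamma_add_natCast_ne_zero hc k
  have := gamma_add_natCast_ne_zero hd k
  field_simp

theorem convergesOnUnit_gammaQuot (ha : ∀ m : ℕ, a ≠ -m) (hb : ∀ m : ℕ, b ≠ -m)
    (hc : ∀ m : ℕ, c ≠ -m) (hd : ∀ m : ℕ, d ≠ -m) : ConvergesOnUnit (gammaQuot a b c d) := by
  refine convergesOnUnit_of_ratio (gammaQuot_ne_zero ha hb hc hd) ?_
  have h := (tendsto_add_div_add_natCast a c).mul (tendsto_add_div_add_natCast b d)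
  rw [mul_one] at h
  refine h.congr fun k => ?_
  rw [gammaQuot_succ ha hb hc hd, mul_div_assoc, div_self (gammaQuot_ne_zero ha hb hc hd k),
    mul_one]

/-- The binomial series with negative exponent `-a`. -/
theorem tsum_gammaQuot_binomial (ha : 0 < a) (hb : 0 < b) {x : ℝ} (hx : |x| < 1) :
    ∑' k, gammaQuot a b b 1 k * x ^ k = Real.Gamma a * (1 - x) ^ (-a) := by
  have ha' := ne_neg_natCast_of_pos ha
  have hb' := ne_neg_natCast_of_pos hb
  have h1' := ne_neg_natCast_of_pos one_pos
  have hw := convergesOnUnit_gammaQuot ha' hb' hb' h1'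
  set w := gammaQuot a b b 1 with hw_def
  have hrec (k : ℕ) : (k + 1) * w (k + 1) = (a + k) * w k := by
    have := add_natCast_ne_zero hb' k
    have := add_natCast_ne_zero h1' k
    rw [hw_def, gammaQuot_succ ha' hb' hb' h1']
    field_simp
    ring
  have hder (y : ℝ) (hy : |y| < 1) :
      HasDerivAt (fun y => (1 - y) ^ a * ∑' k, w k * y ^ k) 0 y := by
    have hy1 : 0 < 1 - y := by linarith [(abs_lt.1 hy).2]
    have hode : ∑' k : ℕ, (k + 1) * w (k + 1) * y ^ k =
        a * (∑' k, w k * y ^ k) + y * ∑' k : ℕ, (k + 1) * w (k + 1) * y ^ k := by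
      refine (hw.deriv.hasSum hy).unique
        ((((hw.hasSum hy).mul_left a).add (hw.hasSum_nat_mul hy)).of_eq (fun k => ?_) rfl)
      rw [hrec]
      ring
    have h1 := (((hasDerivAt_id y).const_sub 1).rpow_const (p := a) (Or.inl hy1.ne')).mul
      (hw.hasDerivAt hy)
    refine h1.congr_deriv ?_
    set F' := ∑' k : ℕ, (k + 1) * w (k + 1) * y ^ k
    simp only [id]
    rw [Real.rpow_sub_one hy1.ne']
    field_simp
    linear_combination (1 - y) ^ a * hode
  have hconst := isOpen_Ioo.is_const_of_deriv_eq_zero isPreconnected_Ioo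
    (fun y (hy : y ∈ Ioo (-1 : ℝ) 1) =>
      (hder y (abs_lt.2 hy)).differentiableAt.differentiableWithinAt)
    (fun y hy => (hder y (abs_lt.2 hy)).deriv) (abs_lt.1 hx) (show (0 : ℝ) ∈ Ioo (-1 : ℝ) 1 by simp)
  have h0 : ∑' k, w k * (0 : ℝ) ^ k = Real.Gamma a := by
    rw [tsum_eq_single 0 fun k hk => by simp [hk]]
    have := (Real.Gamma_pos_of_pos hb).ne'
    simp [hw_def, gammaQuot]
    field_simp
  simp only [sub_zero, Real.one_rpow, one_mul, h0] at hconst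
  have hx1 : 0 < 1 - x := by linarith [(abs_lt.1 hx).2]
  rw [Real.rpow_neg hx1.le, ← hconst]
  have := (Real.rpow_pos_of_pos hx1 a).ne'
  field_simp

end GammaQuotient

/-- If `a k ~ b k` with `b` positive, and `(1 - x) ^ α * ∑ b k x ^ k` is constant, then
`(1 - x) ^ α * ∑ a k x ^ k` tends to the same constant as `x → 1`. -/
theorem tendsto_one_sub_rpow_mul_tsum {a b : ℕ → ℝ} (hb0 : ∀ k, 0 < b k)
    (ha : ConvergesOnUnit a) (hb : ConvergesOnUnit b)
    (h : Tendsto (fun k => a k / b k) atTop (𝓝 1)) {α L : ℝ} (hα : 0 < α)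
    (hL : ∀ x ∈ Ioo (0 : ℝ) 1, (1 - x) ^ α * ∑' k, b k * x ^ k = L) :
    Tendsto (fun x : ℝ => (1 - x) ^ α * ∑' k, a k * x ^ k) (𝓝[<] 1) (𝓝 L) := by
  have hLpos : 0 ≤ L := by
    rw [← hL (1 / 2) (by norm_num)]
    exact mul_nonneg (Real.rpow_nonneg (by norm_num) _)
      (tsum_nonneg fun k => mul_nonneg (hb0 k).le (by positivity))
  rw [Metric.tendsto_nhds]
  intro ε hε
  obtain ⟨δ, hδ, hδL⟩ : ∃ δ > 0, δ * L < ε / 2 := by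
    refine ⟨ε / (2 * (L + 1)), by positivity, ?_⟩
    rw [div_mul_eq_mul_div, div_lt_div_iff₀ (by positivity) (by positivity)]
    nlinarith
  obtain ⟨N, hN⟩ := eventually_atTop.1 ((Metric.tendsto_nhds.1 h) δ hδ)
  have hN' (k : ℕ) (hk : N ≤ k) : |a k - b k| ≤ δ * b k := by
    have h1 := (hN k hk).le
    rwa [Real.dist_eq, div_sub_one (hb0 k).ne', abs_div, abs_of_pos (hb0 k),
      div_le_iff₀ (hb0 k)] at h1
  set C := ∑ k ∈ Finset.range N, |a k - b k|
  have hlim : Tendsto (fun x : ℝ => (1 - x) ^ α * C) (𝓝[<] 1) (𝓝 0) := by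
    have : ContinuousAt (fun x : ℝ => (1 - x) ^ α * C) 1 :=
      ((continuousAt_const.sub continuousAt_id).rpow_const (Or.inr hα.le)).mul continuousAt_const
    have h2 := this.tendsto
    simp only [sub_self, Real.zero_rpow hα.ne', zero_mul] at h2
    exact h2.mono_left nhdsWithin_le_nhds
  filter_upwards [hlim.eventually_lt_const (half_pos hε), Ioo_mem_nhdsLT (zero_lt_one' ℝ)]
    with x hx1 hx
  have hxa : |x| < 1 := abs_lt.2 ⟨by linarith [hx.1], hx.2⟩
  have h1x : 0 < (1 - x) ^ α := Real.rpow_pos_of_pos (by linarith [hx.2]) _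
  have hsd := (hb.summable hxa)
  have hbound (k : ℕ) : |a k * x ^ k - b k * x ^ k| ≤
      (if k ∈ Finset.range N then |a k - b k| else 0) + δ * (b k * x ^ k) := by
    have hxk : 0 ≤ x ^ k := pow_nonneg hx.1.le k
    have hxk1 : x ^ k ≤ 1 := pow_le_one₀ hx.1.le hx.2.le
    have := (hb0 k).le
    rw [← sub_mul, abs_mul, abs_of_nonneg hxk]
    split_ifs with hk
    · have : 0 ≤ δ * (b k * x ^ k) := by positivity
      nlinarith [abs_nonneg (a k - b k)]
    · rw [zero_add, ← mul_assoc]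
      gcongr
      exact hN' k (by simpa using hk)
  have hfin : HasSum (fun k => if k ∈ Finset.range N then |a k - b k| else 0) C := by
    have h3 : HasSum (fun k => if k ∈ Finset.range N then |a k - b k| else 0)
        (∑ k ∈ Finset.range N, if k ∈ Finset.range N then |a k - b k| else 0) :=
      hasSum_sum_of_ne_finset_zero fun k hk => if_neg hk
    rwa [Finset.sum_congr rfl fun k hk => if_pos hk] at h3
  have htot := hfin.add ((hb.hasSum hxa).mul_left δ)
  have hle : |(∑' k, a k * x ^ k) - ∑' k, b k * x ^ k| ≤ C + δ * ∑' k, b k * x ^ k := by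
    rw [← (ha.summable hxa).tsum_sub hsd, ← Real.norm_eq_abs]
    exact tsum_of_norm_bounded htot hbound
  rw [Real.dist_eq, ← hL x hx, ← mul_sub, abs_mul, abs_of_pos h1x]
  calc _ ≤ (1 - x) ^ α * (C + δ * ∑' k, b k * x ^ k) := by gcongr
    _ = (1 - x) ^ α * C + δ * L := by rw [← hL x hx]; ring
    _ < ε := by linarith

section Connection

variable {a b c d : ℝ}

theorem gammaQuot_zero : gammaQuot a b c d 0 =
    Real.Gamma a * Real.Gamma b / (Real.Gamma c * Real.Gamma d) := by
  simp [gammaQuot]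

theorem gammaQuot_swap_num : gammaQuot a b c d = gammaQuot b a c d := by
  funext k
  rw [gammaQuot, gammaQuot, mul_comm (Real.Gamma (a + k))]

theorem gammaQuot_swap_den : gammaQuot a b c d = gammaQuot a b d c := by
  funext k
  rw [gammaQuot, gammaQuot, mul_comm (Real.Gamma (c + k))]

theorem gammaQuot_add_one_left (ha : ∀ m : ℕ, a ≠ -m) (k : ℕ) :
    gammaQuot (a + 1) b c d k = (a + k) * gammaQuot a b c d k := by
  rw [gammaQuot, gammaQuot, add_right_comm, Real.Gamma_add_one (add_natCast_ne_zero ha k)]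
  ring

theorem tendsto_gammaQuot_div_rpow (ha : ∀ m : ℕ, a ≠ -m) (hb : ∀ m : ℕ, b ≠ -m)
    (hc : ∀ m : ℕ, c ≠ -m) (hd : ∀ m : ℕ, d ≠ -m) :
    Tendsto (fun k : ℕ => gammaQuot a b c d k / (k : ℝ) ^ (a + b - c - d)) atTop (𝓝 1) := by
  have h := ((tendsto_gamma_add_div ha).mul (tendsto_gamma_add_div hb)).div
    ((tendsto_gamma_add_div hc).mul (tendsto_gamma_add_div hd)) (by norm_num)
  rw [mul_one, div_one] at h
  refine h.congr' ?_
  filter_upwards [eventually_gt_atTop 0] with k hk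
  have hk' : (0 : ℝ) < k := by exact_mod_cast hk
  have := (Real.Gamma_pos_of_pos hk').ne'
  have := gamma_add_natCast_ne_zero hc k
  have := gamma_add_natCast_ne_zero hd k
  have hr := fun e : ℝ => (Real.rpow_pos_of_pos hk' e).ne'
  rw [Real.rpow_sub hk', Real.rpow_sub hk', Real.rpow_add hk', gammaQuot]
  simp only [Pi.div_apply]
  have := hr a
  have := hr b
  have := hr c
  have := hr d
  field_simp

/-- `∑ (a+k) w k x ^ k`, where `w` is a Gamma quotient with numerator parameter `a`. -/
theorem tsum_gammaQuot_add_one_left (ha : ∀ m : ℕ, a ≠ -m) (hb : ∀ m : ℕ, b ≠ -m)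
    (hc : ∀ m : ℕ, c ≠ -m) (hd : ∀ m : ℕ, d ≠ -m) {x : ℝ} (hx : |x| < 1) :
    ∑' k, gammaQuot (a + 1) b c d k * x ^ k = a * (∑' k, gammaQuot a b c d k * x ^ k) +
      x * ∑' k : ℕ, (k + 1) * gammaQuot a b c d (k + 1) * x ^ k := by
  have hw := convergesOnUnit_gammaQuot ha hb hc hd
  refine (((hw.hasSum hx).mul_left a).add (hw.hasSum_nat_mul hx)).of_eq (fun k => ?_) rfl |>.tsum_eq
  rw [gammaQuot_add_one_left ha]
  ring

theorem tsum_gammaQuot_add_one_add_one {e : ℝ} (ha : 0 < a) (hb : 0 < b) (he : 0 < e) {t : ℝ}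
    (ht : |t| < 1) :
    (a + e) * ∑' k, gammaQuot (a + 1) b (a + 1 + b + e) 1 k * t ^ k =
      a * (∑' k, gammaQuot a b (a + b + e) 1 k * t ^ k) -
        (1 - t) * ∑' k : ℕ, (k + 1) * gammaQuot a b (a + b + e) 1 (k + 1) * t ^ k := by
  have ha' := ne_neg_natCast_of_pos ha
  have hb' := ne_neg_natCast_of_pos hb
  have h1' := ne_neg_natCast_of_pos one_pos
  have hc0 : 0 < a + b + e := by positivity
  have hc' := ne_neg_natCast_of_pos hc0
  have hw := convergesOnUnit_gammaQuot ha' hb' hc' h1'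
  have h := (((hw.hasSum ht).mul_left a).add (hw.hasSum_nat_mul ht)).sub (hw.deriv.hasSum ht)
  have hw1 := convergesOnUnit_gammaQuot (ne_neg_natCast_of_pos (show 0 < a + 1 by positivity)) hb'
    (ne_neg_natCast_of_pos (show 0 < a + 1 + b + e by positivity)) h1'
  refine ((hw1.hasSum ht).mul_left (a + e)).unique (h.of_eq (fun k => ?_) (by ring))
  have hrec : gammaQuot (a + 1) b (a + 1 + b + e) 1 k =
      (a + k) / (a + b + e + k) * gammaQuot a b (a + b + e) 1 k := by
    rw [gammaQuot_add_one_left ha', show a + 1 + b + e = a + b + e + 1 by ring, gammaQuot,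
      gammaQuot, add_right_comm, Real.Gamma_add_one (add_natCast_ne_zero hc' k)]
    have := gamma_add_natCast_ne_zero hc' k
    have := gamma_add_natCast_ne_zero h1' k
    have := add_natCast_ne_zero hc' k
    field_simp
  rw [hrec, gammaQuot_succ ha' hb' hc' h1']
  have := add_natCast_ne_zero hc' k
  have := add_natCast_ne_zero h1' k
  field_simp
  ring

/-- The first-order differential equation satisfied by `₂F₁(1, 1; d; x)`. -/
theorem gammaQuot_one_one_ode (hd : ∀ m : ℕ, d ≠ -m) {x : ℝ} (hx : |x| < 1) (hx0 : x ≠ 0) :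
    (1 - x) * (∑' k : ℕ, (k + 1) * gammaQuot 1 1 d 1 (k + 1) * x ^ k) -
        ∑' k, gammaQuot 1 1 d 1 k * x ^ k =
      (1 - d) * (((∑' k, gammaQuot 1 1 d 1 k * x ^ k) - 1 / Real.Gamma d) / x) := by
  have h1' := ne_neg_natCast_of_pos one_pos
  have hw := convergesOnUnit_gammaQuot h1' h1' hd h1'
  have h := ((hw.deriv.hasSum hx).sub (hw.hasSum_nat_mul hx)).sub (hw.hasSum hx)
  have h0 : gammaQuot 1 1 d 1 0 = 1 / Real.Gamma d := by simp [gammaQuot_zero]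
  rw [← h0]
  refine (h.of_eq (fun k => ?_) (by ring)).unique ((hw.hasSum_succ hx hx0).mul_left (1 - d))
  rw [gammaQuot_succ h1' h1' hd h1']
  have := add_natCast_ne_zero hd k
  have := add_natCast_ne_zero h1' k
  field_simp
  ring

/-- The connection formula relating the hypergeometric series at `1 - x` to the series at `x`. -/
def ConnectionFormula (ν p q : ℝ) : Prop :=
  ∀ x ∈ Ioo (0 : ℝ) 1,
    Real.Gamma (ν + p) * Real.Gamma (ν + q) / Real.Gamma ν *
        ∑' k, gammaQuot p q (p + q + ν) 1 k * (1 - x) ^ k =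
      Real.Gamma (1 - ν) * ((∑' k, gammaQuot p q (1 - ν) 1 k * x ^ k) -
        x ^ ν * ∑' k, gammaQuot (p + ν) (q + ν) 1 (1 + ν) k * x ^ k)

namespace ConnectionFormula

variable {ν p q : ℝ}

theorem symm (h : ConnectionFormula ν p q) : ConnectionFormula ν q p := by
  intro x hx
  have := h x hx
  rw [gammaQuot_swap_num, gammaQuot_swap_num (a := q + ν), gammaQuot_swap_num (a := q),
    add_comm q p, mul_comm (Real.Gamma (ν + q))]
  exact this

theorem add_one_left (h : ConnectionFormula ν p q) (hν : 0 < ν) (hν' : ∀ m : ℕ, 1 - ν ≠ -m)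
    (hp : 0 < p) (hq : 0 < q) : ConnectionFormula ν (p + 1) q := by
  intro x hx
  have hx1 : |x| < 1 := abs_lt.2 ⟨by linarith [hx.1], hx.2⟩
  have ht1 : |1 - x| < 1 := abs_lt.2 ⟨by linarith [hx.2], by linarith [hx.1]⟩
  have hp' := ne_neg_natCast_of_pos hp
  have hq' := ne_neg_natCast_of_pos hq
  have h1' := ne_neg_natCast_of_pos one_pos
  have hpν' := ne_neg_natCast_of_pos (add_pos hp hν)
  have hqν' := ne_neg_natCast_of_pos (add_pos hq hν)
  have hν1' := ne_neg_natCast_of_pos (add_pos one_pos hν)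
  have hc' := ne_neg_natCast_of_pos (add_pos (add_pos hp hq) hν)
  have hG := convergesOnUnit_gammaQuot hp' hq' hc' h1'
  have hH := convergesOnUnit_gammaQuot hp' hq' hν' h1'
  have hK := convergesOnUnit_gammaQuot hpν' hqν' h1' hν1'
  have dl := ((hG.hasDerivAt ht1).comp x ((hasDerivAt_id x).const_sub 1)).const_mul
    (Real.Gamma (ν + p) * Real.Gamma (ν + q) / Real.Gamma ν)
  have dr := ((hH.hasDerivAt hx1).sub
    ((Real.hasDerivAt_rpow_const (p := ν) (Or.inl hx.1.ne')).mul (hK.hasDerivAt hx1))).const_mul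
      (Real.Gamma (1 - ν))
  have hd := (dl.congr_of_eventuallyEq (by
    filter_upwards [Ioo_mem_nhds hx.1 hx.2] with y hy using (h y hy).symm)).unique dr
  have h0 := h x hx
  have hGr := tsum_gammaQuot_add_one_add_one hp hq hν ht1
  have hHr := tsum_gammaQuot_add_one_left hp' hq' hν' h1' hx1
  have hKr := tsum_gammaQuot_add_one_left hpν' hqν' h1' hν1' hx1
  rw [add_right_comm p 1 ν, hHr, hKr, show ν + (p + 1) = ν + p + 1 by ring,
    Real.Gamma_add_one (by positivity)]
  have hxν : x * (ν * x ^ (ν - 1)) = ν * x ^ ν := by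
    rw [Real.rpow_sub_one hx.1.ne']
    field_simp [hx.1.ne']
  set A := Real.Gamma (ν + p) * Real.Gamma (ν + q) / Real.Gamma ν with hA
  have hA' : (ν + p) * Real.Gamma (ν + p) * Real.Gamma (ν + q) / Real.Gamma ν = (p + ν) * A := by
    rw [hA]; ring
  rw [hA', mul_right_comm, mul_comm, hGr]
  linear_combination p * h0 + x * hd - Real.Gamma (1 - ν) *
    (∑' k, gammaQuot (p + ν) (q + ν) 1 (1 + ν) k * x ^ k) * hxν

theorem one_one (hν : 0 < ν) (hν' : ∀ m : ℕ, 1 - ν ≠ -m) : ConnectionFormula ν 1 1 := by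
  have h1' := ne_neg_natCast_of_pos one_pos
  have h1ν : 0 < 1 + ν := by positivity
  have h1ν' := ne_neg_natCast_of_pos h1ν
  have hd0 : 0 < 1 + 1 + ν := by positivity
  have hd' := ne_neg_natCast_of_pos hd0
  have hG := convergesOnUnit_gammaQuot h1' h1' hd' h1'
  have hH := convergesOnUnit_gammaQuot h1' h1' hν' h1'
  have hΓν := (Real.Gamma_pos_of_pos hν).ne'
  have hΓν1 := (Real.Gamma_pos_of_pos h1ν).ne'
  have hΓ1ν := Real.Gamma_ne_zero hν'
  have hA : Real.Gamma (ν + 1) * Real.Gamma (ν + 1) / Real.Gamma ν = ν * Real.Gamma (1 + ν) := by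
    rw [add_comm 1 ν, Real.Gamma_add_one hν.ne']
    field_simp
  have hΓd : Real.Gamma (1 + 1 + ν) = (1 + ν) * Real.Gamma (1 + ν) := by
    rw [← Real.Gamma_add_one h1ν.ne']
    ring_nf
  set G : ℝ → ℝ := fun t => ∑' k, gammaQuot 1 1 (1 + 1 + ν) 1 k * t ^ k with hG_def
  set H : ℝ → ℝ := fun x => ∑' k, gammaQuot 1 1 (1 - ν) 1 k * x ^ k with hH_def
  set E : ℝ → ℝ := fun x => x ^ (-ν) * (1 - x) ^ (1 + ν) *
    (ν * Real.Gamma (1 + ν) * G (1 - x) - Real.Gamma (1 - ν) * H x) with hE_def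
  have hE' : ∀ x ∈ Ioo (0 : ℝ) 1, HasDerivAt E 0 x := by
    intro x hx
    have hx0 := hx.1.ne'
    have h1x : 1 - x ≠ 0 := by linarith [hx.2]
    have hx1 : |x| < 1 := abs_lt.2 ⟨by linarith [hx.1], hx.2⟩
    have ht1 : |1 - x| < 1 := abs_lt.2 ⟨by linarith [hx.2], by linarith [hx.1]⟩
    have d1 := Real.hasDerivAt_rpow_const (p := -ν) (Or.inl hx0)
    have d2 := ((hasDerivAt_id x).const_sub 1).rpow_const (p := 1 + ν) (Or.inl h1x)
    have d3 := ((hG.hasDerivAt ht1).comp x ((hasDerivAt_id x).const_sub 1)).const_mul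
      (ν * Real.Gamma (1 + ν))
    have d4 := (hH.hasDerivAt hx1).const_mul (Real.Gamma (1 - ν))
    refine ((d1.mul d2).mul (d3.sub d4)).congr_deriv ?_
    have o1 := gammaQuot_one_one_ode hd' ht1 h1x
    have o2 := gammaQuot_one_one_ode hν' hx1 hx0
    simp only [id, Function.comp, Pi.mul_apply, Pi.sub_apply]
    set G' := ∑' k : ℕ, (k + 1) * gammaQuot 1 1 (1 + 1 + ν) 1 (k + 1) * (1 - x) ^ k
    set H' := ∑' k : ℕ, (k + 1) * gammaQuot 1 1 (1 - ν) 1 (k + 1) * x ^ k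
    set g := ∑' k : ℕ, gammaQuot 1 1 (1 + 1 + ν) 1 k * (1 - x) ^ k
    set h := ∑' k : ℕ, gammaQuot 1 1 (1 - ν) 1 k * x ^ k
    rw [hΓd] at o1
    rw [Real.rpow_sub_one hx0, Real.rpow_sub_one h1x]
    field_simp at o1 o2 ⊢
    have o1' : (1 - x) * (x * G' - g) * Real.Gamma (1 + ν) =
        1 - g * (1 + ν) * Real.Gamma (1 + ν) := by
      refine mul_right_cancel₀ h1ν.ne' ?_
      linear_combination o1
    linear_combination x ^ (-ν) * (1 - x) ^ (1 + ν) * (-ν * o1' - o2)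
  have hlim : Tendsto E (𝓝[<] 1) (𝓝 (-(Real.Gamma (1 - ν) * Real.Gamma (1 + ν)))) := by
    have hab : Tendsto (fun x => (1 - x) ^ (1 + ν) * H x) (𝓝[<] 1) (𝓝 (Real.Gamma (1 + ν))) := by
      refine tendsto_one_sub_rpow_mul_tsum (b := gammaQuot (1 + ν) 1 1 1)
        (gammaQuot_pos h1ν one_pos one_pos one_pos) hH
        (convergesOnUnit_gammaQuot h1ν' h1' h1' h1') ?_ h1ν fun x hx => ?_
      · refine (tendsto_gammaQuot_div_rpow h1' h1' hν' h1ν').congr fun k => ?_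
        have := gamma_add_natCast_ne_zero h1' k
        have := gamma_add_natCast_ne_zero hν' k
        have := gamma_add_natCast_ne_zero h1ν' k
        rw [show (1 : ℝ) + 1 - (1 - ν) - (1 + ν) = 0 by ring, Real.rpow_zero]
        unfold gammaQuot
        field_simp
      · have h1x : 0 < 1 - x := by linarith [hx.2]
        rw [tsum_gammaQuot_binomial h1ν one_pos (abs_lt.2 ⟨by linarith [hx.1], hx.2⟩),
          Real.rpow_neg h1x.le]
        have := (Real.rpow_pos_of_pos h1x (1 + ν)).ne'
        field_simp
    have c1 : ContinuousAt (fun x : ℝ => x ^ (-ν)) 1 :=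
      Real.continuousAt_rpow_const _ _ (Or.inl one_ne_zero)
    have c2 : ContinuousAt (fun x : ℝ => (1 - x) ^ (1 + ν)) 1 :=
      (continuousAt_const.sub continuousAt_id).rpow_const (Or.inr h1ν.le)
    have c3 : ContinuousAt (fun x : ℝ => G (1 - x)) 1 := by
      refine ContinuousAt.comp (g := G) ?_ (continuousAt_const.sub continuousAt_id)
      exact (hG.hasDerivAt (by simp)).continuousAt
    have t1 := c1.tendsto.mono_left (nhdsWithin_le_nhds (s := Iio 1))
    have t2 := ((c2.mul c3).const_mul (ν * Real.Gamma (1 + ν))).tendsto.mono_left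
      (nhdsWithin_le_nhds (s := Iio 1))
    have t3 := t1.mul (t2.sub (hab.const_mul (Real.Gamma (1 - ν))))
    simp only [Real.one_rpow, sub_self, Real.zero_rpow h1ν.ne', zero_mul, mul_zero, one_mul,
      zero_sub, Pi.mul_apply] at t3
    refine t3.congr fun x => ?_
    rw [hE_def]
    ring
  intro x hx
  have hconst : ∀ y ∈ Ioo (0 : ℝ) 1, E y = E x := fun y hy =>
    isOpen_Ioo.is_const_of_deriv_eq_zero isPreconnected_Ioo
      (fun y hy => (hE' y hy).differentiableAt.differentiableWithinAt)
      (fun y hy => (hE' y hy).deriv) hy hx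
  have hEx : E x = -(Real.Gamma (1 - ν) * Real.Gamma (1 + ν)) := by
    refine tendsto_nhds_unique (tendsto_const_nhds.congr' ?_) hlim
    filter_upwards [Ioo_mem_nhdsLT (zero_lt_one' ℝ)] with y hy using (hconst y hy).symm
  have h1x : 0 < 1 - x := by linarith [hx.2]
  rw [hA, gammaQuot_swap_den (c := 1),
    tsum_gammaQuot_binomial h1ν h1ν (abs_lt.2 ⟨by linarith [hx.1], hx.2⟩), Real.rpow_neg h1x.le]
  have e1 := (Real.rpow_pos_of_pos h1x (1 + ν)).ne'
  have e2 := (Real.rpow_pos_of_pos hx.1 ν).ne'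
  simp only [hE_def, hG_def, hH_def] at hEx
  rw [Real.rpow_neg hx.1.le] at hEx
  field_simp at hEx ⊢
  linear_combination hEx

theorem of_nat (hν : 0 < ν) (hν' : ∀ m : ℕ, 1 - ν ≠ -m) {p q : ℕ} (hp : 1 ≤ p) (hq : 1 ≤ q) :
    ConnectionFormula ν p q := by
  have hp1 : ConnectionFormula ν p 1 := by
    induction p, hp using Nat.le_induction with
    | base => simpa using one_one hν hν'
    | succ p hp ih =>
      push_cast
      exact ih.add_one_left hν hν' (by positivity) one_pos
  refine symm ?_
  induction q, hq using Nat.le_induction with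
  | base => simpa using hp1.symm
  | succ q hq ih =>
    push_cast
    exact ih.add_one_left hν hν' (by positivity) (by positivity)

end ConnectionFormula

end Connection

section Integrals

theorem integrableOn_beta {a b : ℝ} (ha : 0 < a) (hb : 0 < b) :
    IntegrableOn (fun x : ℝ => x ^ (a - 1) * (1 - x) ^ (b - 1)) (Ioo 0 1) ∧
      ∫ x in Ioo (0 : ℝ) 1, x ^ (a - 1) * (1 - x) ^ (b - 1) =
        Real.Gamma a * Real.Gamma b / Real.Gamma (a + b) := by
  have hval : ∫ x in Ioo (0 : ℝ) 1, x ^ (a - 1) * (1 - x) ^ (b - 1) =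
      Real.Gamma a * Real.Gamma b / Real.Gamma (a + b) := by
    have h := Complex.betaIntegral_eq_Gamma_mul_div a b (by simpa) (by simpa)
    rw [Complex.betaIntegral, intervalIntegral.integral_of_le zero_le_one,
      integral_Ioc_eq_integral_Ioo, setIntegral_congr_fun measurableSet_Ioo
        (g := fun x : ℝ => ((x ^ (a - 1) * (1 - x) ^ (b - 1) : ℝ) : ℂ)), integral_complex_ofReal,
      ← Complex.ofReal_add, Complex.Gamma_ofReal, Complex.Gamma_ofReal, Complex.Gamma_ofReal] at h
    · exact_mod_cast h
    · intro x hx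
      have : 0 ≤ 1 - x := by linarith [hx.2]
      push_cast [Complex.ofReal_cpow hx.1.le, Complex.ofReal_cpow this]
      rfl
  refine ⟨.of_integral_ne_zero ?_, hval⟩
  rw [hval]
  have := Real.Gamma_pos_of_pos ha
  have := Real.Gamma_pos_of_pos hb
  have := Real.Gamma_pos_of_pos (add_pos ha hb)
  positivity

/-- Termwise integration of a series of nonnegative functions with integrable sum. -/
theorem hasSum_integral_of_nonneg {α : Type*} [MeasurableSpace α] {μ : Measure α}
    {f : ℕ → α → ℝ} {F : α → ℝ} (hf : ∀ k, Integrable (f k) μ) (hF : Integrable F μ)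
    (h0 : ∀ k, 0 ≤ᵐ[μ] f k) (hs : ∀ᵐ x ∂μ, HasSum (fun k => f k x) (F x)) :
    HasSum (fun k => ∫ x, f k x ∂μ) (∫ x, F x ∂μ) := by
  have hae : ∀ᵐ x ∂μ, ∀ k, 0 ≤ f k x := ae_all_iff.2 h0
  have hsum : Summable fun k => ∫ x, f k x ∂μ := by
    refine summable_of_sum_le (c := ∫ x, F x ∂μ) (fun k => integral_nonneg_of_ae (h0 k)) fun s => ?_
    rw [← integral_finsetSum s fun k _ => hf k]
    refine integral_mono_ae (integrable_finsetSum s fun k _ => hf k) hF ?_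
    filter_upwards [hae, hs] with x hx hsx
    exact sum_le_hasSum s (fun k _ => hx k) hsx
  have hn : (fun k => ∫ x, ‖f k x‖ ∂μ) = fun k => ∫ x, f k x ∂μ := by
    funext k
    refine integral_congr_ae ?_
    filter_upwards [h0 k] with x hx using Real.norm_of_nonneg hx
  have h := hasSum_integral_of_summable_integral_norm hf (hn ▸ hsum)
  rwa [integral_congr_ae (by filter_upwards [hs] with x hx using hx.tsum_eq)] at h

/-- Gauss's summation theorem. -/
theorem hasSum_gammaQuot_gauss {a b c : ℝ} (ha : 0 < a) (hb : 0 < b) (hc : a + b < c) :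
    HasSum (gammaQuot a b c 1) (Real.Gamma a * Real.Gamma b * Real.Gamma (c - a - b) /
      (Real.Gamma (c - a) * Real.Gamma (c - b))) := by
  have hcb : 0 < c - b := by linarith
  have hcab : 0 < c - a - b := by linarith
  have hbk (k : ℕ) : 0 < b + k := by positivity
  have key := hasSum_integral_of_nonneg (μ := volume.restrict (Ioo (0 : ℝ) 1))
    (f := fun k x => gammaQuot a b b 1 k * (x ^ (b + k - 1) * (1 - x) ^ (c - b - 1)))
    (F := fun x => Real.Gamma a * (x ^ (b - 1) * (1 - x) ^ (c - a - b - 1)))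
    (fun k => (integrableOn_beta (hbk k) hcb).1.const_mul _)
    ((integrableOn_beta hb hcab).1.const_mul _)
    (fun k => by
      filter_upwards [ae_restrict_mem measurableSet_Ioo] with x hx
      have h1 := gammaQuot_pos ha hb hb one_pos k
      have h2 : 0 < 1 - x := by linarith [hx.2]
      have h3 := hx.1
      simp only [Pi.zero_apply]
      positivity)
    (by
      filter_upwards [ae_restrict_mem measurableSet_Ioo] with x hx
      have hx1 : |x| < 1 := abs_lt.2 ⟨by linarith [hx.1], hx.2⟩
      have h1x : 0 < 1 - x := by linarith [hx.2]
      have h := ((convergesOnUnit_gammaQuot (ne_neg_natCast_of_pos ha) (ne_neg_natCast_of_pos hb)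
        (ne_neg_natCast_of_pos hb) (ne_neg_natCast_of_pos one_pos)).hasSum hx1).mul_right
          (x ^ (b - 1) * (1 - x) ^ (c - b - 1))
      refine h.of_eq (fun k => ?_) ?_
      · rw [show b + k - 1 = b - 1 + k by ring, Real.rpow_add hx.1, Real.rpow_natCast]
        ring
      · rw [tsum_gammaQuot_binomial ha hb hx1, show c - a - b - 1 = -a + (c - b - 1) by ring,
          Real.rpow_add h1x]
        ring)
  simp only [integral_const_mul, (integrableOn_beta (hbk _) hcb).2,
    (integrableOn_beta hb hcab).2] at key
  have hΓcb := (Real.Gamma_pos_of_pos hcb).ne'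
  have hΓca := (Real.Gamma_pos_of_pos (show 0 < c - a by linarith)).ne'
  refine (key.div_const (Real.Gamma (c - b))).of_eq (fun k => ?_) ?_
  · have := (Real.Gamma_pos_of_pos (hbk k)).ne'
    rw [show b + k + (c - b) = c + k by ring, gammaQuot, gammaQuot]
    field_simp
  · rw [show b + (c - a - b) = c - a by ring]
    field_simp

theorem tsum_gammaQuot_nonneg {a b c d x : ℝ} (ha : 0 < a) (hb : 0 < b) (hc : 0 < c) (hd : 0 < d)
    (hx : 0 ≤ x) : 0 ≤ ∑' k, gammaQuot a b c d k * x ^ k :=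
  tsum_nonneg fun k => mul_nonneg (gammaQuot_pos ha hb hc hd k).le (pow_nonneg hx k)

/-- A Mellin-type transform of the Gauss hypergeometric series. -/
theorem integrableOn_rpow_mul_tsum_gammaQuot {p q ν σ : ℝ} (hp : 0 < p) (hq : 0 < q) (hν : 0 < ν)
    (hσ : -1 < σ) :
    IntegrableOn (fun t : ℝ => t ^ (p + q + ν - 1) * (1 - t) ^ σ *
      ∑' k, gammaQuot p q (p + q + ν) 1 k * t ^ k) (Ioo 0 1) ∧
    ∫ t in Ioo (0 : ℝ) 1, t ^ (p + q + ν - 1) * (1 - t) ^ σ *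
        ∑' k, gammaQuot p q (p + q + ν) 1 k * t ^ k =
      Real.Gamma p * Real.Gamma q * Real.Gamma (σ + 1) * Real.Gamma (ν + σ + 1) /
        (Real.Gamma (p + ν + σ + 1) * Real.Gamma (q + ν + σ + 1)) := by
  have hc : 0 < p + q + ν := by positivity
  have hσ1 : 0 < σ + 1 := by linarith
  have hck (k : ℕ) : 0 < p + q + ν + k := by positivity
  set f : ℕ → ℝ → ℝ := fun k t =>
    gammaQuot p q (p + q + ν) 1 k * (t ^ (p + q + ν + k - 1) * (1 - t) ^ (σ + 1 - 1)) with hf_def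
  have hfi (k : ℕ) : Integrable (f k) (volume.restrict (Ioo 0 1)) :=
    (integrableOn_beta (hck k) hσ1).1.const_mul _
  have hint (k : ℕ) : ∫ t in Ioo (0 : ℝ) 1, f k t =
      Real.Gamma (σ + 1) * gammaQuot p q (p + q + ν + σ + 1) 1 k := by
    rw [hf_def, integral_const_mul, (integrableOn_beta (hck k) hσ1).2,
      show p + q + ν + k + (σ + 1) = p + q + ν + σ + 1 + k by ring, gammaQuot, gammaQuot]
    have := (Real.Gamma_pos_of_pos (hck k)).ne'
    field_simp
  have hnorm (k : ℕ) : ∫ t in Ioo (0 : ℝ) 1, ‖f k t‖ = ∫ t in Ioo (0 : ℝ) 1, f k t := by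
    refine setIntegral_congr_fun measurableSet_Ioo fun t ht => Real.norm_of_nonneg ?_
    have h1 := gammaQuot_pos hp hq hc one_pos k
    have h2 : 0 < 1 - t := by linarith [ht.2]
    have h3 := ht.1
    simp only [hf_def]
    positivity
  have hg := (hasSum_gammaQuot_gauss hp hq (c := p + q + ν + σ + 1) (by linarith)).mul_left
    (Real.Gamma (σ + 1))
  have hsum := hasSum_integral_of_summable_integral_norm hfi
    (by simpa only [hnorm, hint] using hg.summable)
  simp only [hint] at hsum
  have hval := hsum.unique hg
  have hpt : ∫ t in Ioo (0 : ℝ) 1, t ^ (p + q + ν - 1) * (1 - t) ^ σ *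
      ∑' k, gammaQuot p q (p + q + ν) 1 k * t ^ k = ∫ t in Ioo (0 : ℝ) 1, ∑' k, f k t := by
    refine setIntegral_congr_fun measurableSet_Ioo fun t ht => ?_
    simp only [hf_def]
    rw [← _root_.tsum_mul_left]
    refine tsum_congr fun k => ?_
    rw [show p + q + ν + k - 1 = p + q + ν - 1 + k by ring, Real.rpow_add ht.1, Real.rpow_natCast,
      add_sub_cancel_right]
    ring
  have hval' := hpt.trans hval
  rw [show p + q + ν + σ + 1 - p - q = ν + σ + 1 by ring,
    show p + q + ν + σ + 1 - p = q + ν + σ + 1 by ring,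
    show p + q + ν + σ + 1 - q = p + ν + σ + 1 by ring] at hval'
  refine ⟨.of_integral_ne_zero ?_, hval'.trans (by ring)⟩
  rw [hval']
  have := Real.Gamma_pos_of_pos hp
  have := Real.Gamma_pos_of_pos hq
  have := Real.Gamma_pos_of_pos hσ1
  have := Real.Gamma_pos_of_pos (show 0 < ν + σ + 1 by linarith)
  have := Real.Gamma_pos_of_pos (show 0 < p + ν + σ + 1 by linarith)
  have := Real.Gamma_pos_of_pos (show 0 < q + ν + σ + 1 by linarith)
  positivity

end Integrals

section Coefficients

variable {ν s : ℝ} {p q : ℕ}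

theorem summable_gammaQuot_mul_gammaQuot {a b c d a' b' c' d' : ℝ}
    (ha : ∀ m : ℕ, a ≠ -m) (hb : ∀ m : ℕ, b ≠ -m) (hc : ∀ m : ℕ, c ≠ -m) (hd : ∀ m : ℕ, d ≠ -m)
    (ha' : ∀ m : ℕ, a' ≠ -m) (hb' : ∀ m : ℕ, b' ≠ -m) (hc' : ∀ m : ℕ, c' ≠ -m)
    (hd' : ∀ m : ℕ, d' ≠ -m) (h : a + b - c - d + (a' + b' - c' - d') = -2) :
    Summable fun k => gammaQuot a b c d k * gammaQuot a' b' c' d' k := by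
  have hlim := (tendsto_gammaQuot_div_rpow ha hb hc hd).mul
    (tendsto_gammaQuot_div_rpow ha' hb' hc' hd')
  refine summable_of_isBigO_nat (Real.summable_nat_rpow.2 (by norm_num : (-2 : ℝ) < -1)) ?_
  refine Asymptotics.isBigO_of_div_tendsto_nhds ?_ _ (hlim.congr' ?_)
  · filter_upwards [eventually_gt_atTop 0] with k hk h0
    have hk' : (0 : ℝ) < k := by exact_mod_cast hk
    exact absurd h0 (Real.rpow_pos_of_pos hk' _).ne'
  · filter_upwards [eventually_gt_atTop 0] with k hk
    have hk' : (0 : ℝ) < k := by exact_mod_cast hk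
    simp only [Pi.div_apply]
    rw [← h, Real.rpow_add hk', div_mul_div_comm]

theorem SpqR_eq (hν : 0 < ν) (hp : 1 ≤ p) (hq : 1 ≤ q) (t : ℝ) :
    SpqR ν p q t = Real.Gamma (ν + p) * Real.Gamma (ν + q) / Real.Gamma ν *
      (∑' k, gammaQuot p q (p + q + ν) 1 k * t ^ k) / (Real.Gamma p * Real.Gamma q) := by
  have hΓp := (Real.Gamma_pos_of_pos (show (0 : ℝ) < p by positivity)).ne'
  have hΓq := (Real.Gamma_pos_of_pos (show (0 : ℝ) < q by positivity)).ne'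
  have hΓν := (Real.Gamma_pos_of_pos hν).ne'
  have hΓc := (Real.Gamma_pos_of_pos (show (0 : ℝ) < p + q + ν by positivity)).ne'
  rw [SpqR, hyp2F1, ← _root_.tsum_mul_left, ← _root_.tsum_mul_left, ← _root_.tsum_div_const]
  refine tsum_congr fun k => ?_
  have := (Real.Gamma_pos_of_pos (show (0 : ℝ) < p + q + ν + k by positivity)).ne'
  have := (Nat.cast_ne_zero (R := ℝ)).2 k.factorial_ne_zero
  rw [poch, poch, poch, gammaQuot, add_comm 1 (k : ℝ), Real.Gamma_nat_eq_factorial,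
    show ν + p + q = p + q + ν by ring]
  field_simp

/-- The value of `∫ t ^ (p + q + ν - 1) * (1 - t) ^ σ * S_pq t` over `(0, 1)`. -/
noncomputable def mellinSpq (ν : ℝ) (p q : ℕ) (σ : ℝ) : ℝ :=
  Real.Gamma (ν + p) * Real.Gamma (ν + q) * Real.Gamma (σ + 1) * Real.Gamma (ν + σ + 1) /
    (Real.Gamma ν * Real.Gamma (p + ν + σ + 1) * Real.Gamma (q + ν + σ + 1))

theorem mellinSpq_pos (hν : 0 < ν) (hs : -1 < s) : 0 < mellinSpq ν p q s := by
  have hp : (0 : ℝ) ≤ p := p.cast_nonneg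
  have hq : (0 : ℝ) ≤ q := q.cast_nonneg
  have := Real.Gamma_pos_of_pos hν
  have := Real.Gamma_pos_of_pos (show 0 < s + 1 by linarith)
  have := Real.Gamma_pos_of_pos (show 0 < ν + p by linarith)
  have := Real.Gamma_pos_of_pos (show 0 < ν + q by linarith)
  have := Real.Gamma_pos_of_pos (show 0 < ν + s + 1 by linarith)
  have := Real.Gamma_pos_of_pos (show 0 < p + ν + s + 1 by linarith)
  have := Real.Gamma_pos_of_pos (show 0 < q + ν + s + 1 by linarith)
  unfold mellinSpq
  positivity

theorem integrableOn_mellinSpq (hν : 0 < ν) (hp : 1 ≤ p) (hq : 1 ≤ q) (hs : -1 < s) :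
    IntegrableOn (fun t : ℝ => t ^ ((p : ℝ) + q + ν - 1) * (1 - t) ^ s * SpqR ν p q t) (Ioo 0 1) ∧
    ∫ t in Ioo (0 : ℝ) 1, t ^ ((p : ℝ) + q + ν - 1) * (1 - t) ^ s * SpqR ν p q t =
      mellinSpq ν p q s := by
  have hp0 : (0 : ℝ) < p := by positivity
  have hq0 : (0 : ℝ) < q := by positivity
  obtain ⟨hi, hv⟩ := integrableOn_rpow_mul_tsum_gammaQuot hp0 hq0 hν hs
  have hΓp := (Real.Gamma_pos_of_pos hp0).ne'
  have hΓq := (Real.Gamma_pos_of_pos hq0).ne'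
  have hfun : (fun t : ℝ => t ^ ((p : ℝ) + q + ν - 1) * (1 - t) ^ s * SpqR ν p q t) = fun t =>
      Real.Gamma (ν + p) * Real.Gamma (ν + q) / Real.Gamma ν / (Real.Gamma p * Real.Gamma q) *
        (t ^ ((p : ℝ) + q + ν - 1) * (1 - t) ^ s *
          ∑' k, gammaQuot p q (p + q + ν) 1 k * t ^ k) := by
    funext t
    rw [SpqR_eq hν hp hq]
    ring
  rw [hfun]
  refine ⟨hi.const_mul _, ?_⟩
  rw [integral_const_mul, hv, mellinSpq]
  field_simp

theorem SpqR_nonneg (hν : 0 < ν) (hp : 1 ≤ p) (hq : 1 ≤ q) {t : ℝ} (ht : 0 ≤ t) :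
    0 ≤ SpqR ν p q t := by
  have hp0 : (0 : ℝ) < p := by positivity
  have hq0 : (0 : ℝ) < q := by positivity
  have := tsum_gammaQuot_nonneg hp0 hq0 (show (0 : ℝ) < p + q + ν by positivity) one_pos ht
  have := Real.Gamma_pos_of_pos hp0
  have := Real.Gamma_pos_of_pos hq0
  have := Real.Gamma_pos_of_pos hν
  have := Real.Gamma_pos_of_pos (add_pos hν hp0)
  have := Real.Gamma_pos_of_pos (add_pos hν hq0)
  rw [SpqR_eq hν hp hq]
  positivity

/-- Expansion of `S_pq` at `t = 1`, in powers `(1 - t) ^ k` and `(1 - t) ^ (ν + k)`. -/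
theorem hasSum_SpqR (hν : 0 < ν) (hν' : ∀ m : ℕ, 1 - ν ≠ -m) (hp : 1 ≤ p) (hq : 1 ≤ q) {t : ℝ}
    (ht : t ∈ Ioo (0 : ℝ) 1) :
    HasSum (fun k => Real.Gamma (1 - ν) / (Real.Gamma p * Real.Gamma q) *
      (gammaQuot p q (1 - ν) 1 k * (1 - t) ^ k -
        gammaQuot (p + ν) (q + ν) 1 (1 + ν) k * (1 - t) ^ (ν + k))) (SpqR ν p q t) := by
  have hp0 : (0 : ℝ) < p := by positivity
  have hq0 : (0 : ℝ) < q := by positivity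
  have h1x : 0 < 1 - t := by linarith [ht.2]
  have hx1 : |1 - t| < 1 := abs_lt.2 ⟨by linarith, by linarith [ht.1]⟩
  have h1' := ne_neg_natCast_of_pos one_pos
  have hH := convergesOnUnit_gammaQuot (ne_neg_natCast_of_pos hp0) (ne_neg_natCast_of_pos hq0)
    hν' h1'
  have hK := convergesOnUnit_gammaQuot (ne_neg_natCast_of_pos (add_pos hp0 hν))
    (ne_neg_natCast_of_pos (add_pos hq0 hν)) h1' (ne_neg_natCast_of_pos (add_pos one_pos hν))
  have hconn := ConnectionFormula.of_nat hν hν' hp hq (1 - t) ⟨h1x, by linarith [ht.1]⟩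
  rw [_root_.sub_sub_cancel] at hconn
  refine (((hH.hasSum hx1).sub ((hK.hasSum hx1).mul_left ((1 - t) ^ ν))).mul_left
    (Real.Gamma (1 - ν) / (Real.Gamma p * Real.Gamma q))).of_eq (fun k => ?_) ?_
  · rw [Real.rpow_add h1x, Real.rpow_natCast]
    ring
  · rw [SpqR_eq hν hp hq, hconn]
    ring

theorem hasSum_integral_SpqR_sq (hν : 0 < ν) (hν' : ∀ m : ℕ, 1 - ν ≠ -m) (hp : 1 ≤ p) (hq : 1 ≤ q)
    (hs : -1 < s) {u v : ℕ → ℝ}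
    (hu : ∀ k, u k = Real.Gamma (1 - ν) / (Real.Gamma p * Real.Gamma q) *
      gammaQuot p q (1 - ν) 1 k * mellinSpq ν p q (s + k))
    (hv : ∀ k, v k = Real.Gamma (1 - ν) / (Real.Gamma p * Real.Gamma q) *
      gammaQuot (p + ν) (q + ν) 1 (1 + ν) k * mellinSpq ν p q (s + (ν + k)))
    (hus : Summable u) (hvs : Summable v) :
    HasSum (fun k => u k - v k) (∫ t in Ioo (0 : ℝ) 1,
      t ^ ((p : ℝ) + q + ν - 1) * (1 - t) ^ s * SpqR ν p q t ^ 2) := by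
  set C := Real.Gamma (1 - ν) / (Real.Gamma p * Real.Gamma q)
  set m : ℝ → ℝ → ℝ := fun σ t => t ^ ((p : ℝ) + q + ν - 1) * (1 - t) ^ σ * SpqR ν p q t with hm
  have hσ1 (k : ℕ) : -1 < s + k := by linarith [k.cast_nonneg (α := ℝ)]
  have hσ2 (k : ℕ) : -1 < s + (ν + k) := by linarith [k.cast_nonneg (α := ℝ)]
  have hmi {σ : ℝ} (hσ : -1 < σ) : Integrable (m σ) (volume.restrict (Ioo 0 1)) :=
    (integrableOn_mellinSpq hν hp hq hσ).1
  have hmv {σ : ℝ} (hσ : -1 < σ) : ∫ t in Ioo (0 : ℝ) 1, m σ t = mellinSpq ν p q σ :=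
    (integrableOn_mellinSpq hν hp hq hσ).2
  have hm0 (σ : ℝ) {t : ℝ} (ht : t ∈ Ioo (0 : ℝ) 1) : 0 ≤ m σ t := by
    have h1 := SpqR_nonneg hν hp hq ht.1.le
    have h2 : 0 < 1 - t := by linarith [ht.2]
    have h3 := ht.1
    simp only [hm]
    positivity
  set f : ℕ → ℝ → ℝ := fun k t => C * gammaQuot p q (1 - ν) 1 k * m (s + k) t -
    C * gammaQuot (p + ν) (q + ν) 1 (1 + ν) k * m (s + (ν + k)) t with hf
  have hfi (k : ℕ) : Integrable (f k) (volume.restrict (Ioo 0 1)) :=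
    ((hmi (hσ1 k)).const_mul _).sub ((hmi (hσ2 k)).const_mul _)
  have hfv (k : ℕ) : ∫ t in Ioo (0 : ℝ) 1, f k t = u k - v k := by
    rw [hf, integral_sub ((hmi (hσ1 k)).const_mul _) ((hmi (hσ2 k)).const_mul _),
      integral_const_mul, integral_const_mul, hmv (hσ1 k), hmv (hσ2 k), hu, hv]
  have hfn (k : ℕ) : ∫ t in Ioo (0 : ℝ) 1, ‖f k t‖ ≤ |u k| + |v k| := by
    have hI : Integrable (fun t => |C * gammaQuot p q (1 - ν) 1 k| * m (s + k) t +
        |C * gammaQuot (p + ν) (q + ν) 1 (1 + ν) k| * m (s + (ν + k)) t)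
        (volume.restrict (Ioo 0 1)) :=
      ((hmi (hσ1 k)).const_mul _).add ((hmi (hσ2 k)).const_mul _)
    refine (setIntegral_mono_on (hfi k).norm hI measurableSet_Ioo fun t ht => ?_).trans_eq ?_
    · rw [hf, ← abs_of_nonneg (hm0 (s + k) ht), ← abs_of_nonneg (hm0 (s + (ν + k)) ht), ← abs_mul,
        ← abs_mul]
      exact norm_sub_le _ _
    · rw [integral_add ((hmi (hσ1 k)).const_mul _) ((hmi (hσ2 k)).const_mul _),
        integral_const_mul, integral_const_mul, hmv (hσ1 k), hmv (hσ2 k), hu, hv,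
        abs_mul _ (mellinSpq _ _ _ _), abs_mul _ (mellinSpq _ _ _ _),
        abs_of_pos (mellinSpq_pos hν (hσ1 k)), abs_of_pos (mellinSpq_pos hν (hσ2 k))]
  have hsum := hasSum_integral_of_summable_integral_norm hfi
    (.of_nonneg_of_le (fun k => integral_nonneg fun t => norm_nonneg _) hfn (hus.abs.add hvs.abs))
  simp only [hfv] at hsum
  refine hsum.of_eq (fun k => rfl) (setIntegral_congr_fun measurableSet_Ioo fun t ht => ?_)
  have h1x : 0 < 1 - t := by linarith [ht.2]
  refine (((hasSum_SpqR hν hν' hp hq ht).mul_left (m s t)).of_eq (fun k => ?_) ?_).tsum_eq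
  · simp only [hf, hm]
    rw [Real.rpow_add h1x s k, Real.rpow_add h1x s (ν + k), Real.rpow_natCast]
    ring
  · simp only [hm]
    ring

end Coefficients

/-- Corollary 3.4: series formula for `c_pq(s)` for non-integer dimension parameter. -/
theorem statement3 (ν : ℝ) (hν : 0 < ν) (hνZ : ∀ m : ℤ, ν ≠ m)
    (p q : ℕ) (hp : 1 ≤ p) (hq : 1 ≤ q) (s : ℝ) (hs : -1 < s) :
    let T : ℝ → ℝ := fun u =>
      Real.Gamma (p + u) * Real.Gamma (q + u) * Real.Gamma (p + ν) * Real.Gamma (q + ν) *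
          Real.Gamma (1 - ν) * Real.Gamma (s + u + 1) * Real.Gamma (ν + s + u + 1) /
        (Real.Gamma ν * Real.Gamma (1 - ν + u) * Real.Gamma (1 + u) * Real.Gamma p *
          Real.Gamma q * Real.Gamma (p + ν + s + 1 + u) * Real.Gamma (q + ν + s + 1 + u))
    (Summable fun k : ℕ => |T k|) ∧ (Summable fun k : ℕ => |T (ν + k)|) ∧
      cpqR ν p q s =
        pochR (s + 1) ν / Real.Gamma ν * ((∑' k : ℕ, T k) - ∑' k : ℕ, T (ν + k)) := by
  intro T
  have hν' : ∀ m : ℕ, 1 - ν ≠ -m := fun m h => hνZ (m + 1) (by push_cast; linarith)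
  have hp0 : (0 : ℝ) < p := by positivity
  have hq0 : (0 : ℝ) < q := by positivity
  have hu (k : ℕ) : T k = Real.Gamma (1 - ν) / (Real.Gamma p * Real.Gamma q) *
      gammaQuot p q (1 - ν) 1 k * mellinSpq ν p q (s + k) := by
    simp only [T]
    rw [gammaQuot, mellinSpq, add_comm ν (p : ℝ), add_comm ν (q : ℝ), ← add_assoc ν s k,
      show (p : ℝ) + ν + s + 1 + k = p + ν + (s + k) + 1 by ring,
      show (q : ℝ) + ν + s + 1 + k = q + ν + (s + k) + 1 by ring]
    ring
  have hv (k : ℕ) : T (ν + k) = Real.Gamma (1 - ν) / (Real.Gamma p * Real.Gamma q) *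
      gammaQuot (p + ν) (q + ν) 1 (1 + ν) k * mellinSpq ν p q (s + (ν + k)) := by
    simp only [T]
    rw [gammaQuot, mellinSpq, add_comm ν (p : ℝ), add_comm ν (q : ℝ), ← add_assoc ν s (ν + k),
      ← add_assoc (p : ℝ) ν k, ← add_assoc (q : ℝ) ν k, ← add_assoc 1 ν (k : ℝ),
      show 1 - ν + (ν + k) = 1 + (k : ℝ) by ring,
      show (p : ℝ) + ν + s + 1 + (ν + k) = p + ν + (s + (ν + k)) + 1 by ring,
      show (q : ℝ) + ν + s + 1 + (ν + k) = q + ν + (s + (ν + k)) + 1 by ring]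
    ring
  have npos {a : ℝ} (ha : 0 < a) := ne_neg_natCast_of_pos ha
  have hus : Summable fun k : ℕ => T k := by
    have h := summable_gammaQuot_mul_gammaQuot (npos hp0) (npos hq0) hν' (npos one_pos)
      (npos (show 0 < s + 1 by linarith)) (npos (show 0 < ν + s + 1 by linarith))
      (npos (show 0 < p + ν + s + 1 by linarith)) (npos (show 0 < q + ν + s + 1 by linarith))
      (by ring)
    refine (h.mul_left (Real.Gamma (1 - ν) / (Real.Gamma p * Real.Gamma q) *
      (Real.Gamma (ν + p) * Real.Gamma (ν + q) / Real.Gamma ν))).congr fun k => ?_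
    rw [hu, mellinSpq, gammaQuot, gammaQuot, add_right_comm s 1 (k : ℝ),
      show ν + s + 1 + k = ν + (s + k) + 1 by ring,
      show (p : ℝ) + ν + s + 1 + k = p + ν + (s + k) + 1 by ring,
      show (q : ℝ) + ν + s + 1 + k = q + ν + (s + k) + 1 by ring]
    ring
  have hvs : Summable fun k : ℕ => T (ν + k) := by
    have h := summable_gammaQuot_mul_gammaQuot (npos (add_pos hp0 hν)) (npos (add_pos hq0 hν))
      (npos one_pos) (npos (add_pos one_pos hν))
      (npos (show 0 < s + ν + 1 by linarith)) (npos (show 0 < ν + (s + ν) + 1 by linarith))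
      (npos (show 0 < p + ν + (s + ν) + 1 by linarith))
      (npos (show 0 < q + ν + (s + ν) + 1 by linarith)) (by ring)
    refine (h.mul_left (Real.Gamma (1 - ν) / (Real.Gamma p * Real.Gamma q) *
      (Real.Gamma (ν + p) * Real.Gamma (ν + q) / Real.Gamma ν))).congr fun k => ?_
    rw [hv, mellinSpq, gammaQuot, gammaQuot,
      show s + ν + 1 + (k : ℝ) = s + (ν + k) + 1 by ring,
      show ν + (s + ν) + 1 + k = ν + (s + (ν + k)) + 1 by ring,
      show (p : ℝ) + ν + (s + ν) + 1 + k = p + ν + (s + (ν + k)) + 1 by ring,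
      show (q : ℝ) + ν + (s + ν) + 1 + k = q + ν + (s + (ν + k)) + 1 by ring]
    ring
  refine ⟨hus.abs, hvs.abs, ?_⟩
  rw [cpqR, ← (hasSum_integral_SpqR_sq hν hν' hp hq hs hu hv hus hvs).tsum_eq, hus.tsum_sub hvs]
end
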